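/- arXiv:2103.11913 — 4 statements merged into one kernel-verified Lean document; each statement's English description precedes it below -/
import Mathlib

section
/- Let s, q be positive integers with q < s, let g : [−π,π] → ℂ^{s×s} be a matrix-valued function with Lebesgue integrable entries that is Hermitian positive definite for almost every θ, and let f : [−π,π] → ℂ^{q×s} have Lebesgue integrable entries. Then each matrix T_n(g) is Hermitian positive definite (hence invertible), each matrix T_n(f)·T_n(g)^{−1}·T_n(f^*) is Hermitian of size q·n, and the sequence {T_n(f)·T_n(g)^{−1}·T_n(f^*)}_n is distributed in the sense of the eigenvalues as f·g^{−1}·f^* : [−π,π] → ℂ^{q×q}; explicitly, for every continuous F : ℝ → ℝ with compact support, lim_{n→∞} (1/(q·n)) Σ_{j=1}^{q·n} F(λ_j(T_n(f)T_n(g)^{−1}T_n(f^*))) = (1/(2π)) ∫_{−π}^{π} (1/q) Σ_{i=1}^{q} F(λ_i(f(θ)g(θ)^{−1}f(θ)^*)) dθ, where λ_j denote eigenvalues and f^* is the conjugate transpose of f. -/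
open MeasureTheory Filter Matrix
open scoped ComplexOrder

/-- The `j`-th Fourier coefficient of a matrix-valued function on `[-π, π]`,
computed entrywise: `t_j(f) = (1/(2π)) ∫_{-π}^{π} f(θ) e^{-i j θ} dθ`. -/
noncomputable def fourierCoeffM {s q : ℕ} (f : ℝ → Matrix (Fin s) (Fin q) ℂ) (j : ℤ) :
    Matrix (Fin s) (Fin q) ℂ :=
  Matrix.of fun a b =>
    (1 / (2 * (Real.pi : ℂ))) *
      ∫ θ in (-Real.pi)..Real.pi, f θ a b * Complex.exp (-Complex.I * (j : ℂ) * (θ : ℂ))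

/-- The `n`-th block Toeplitz matrix `T_n(f)` generated by a matrix-valued function `f`:
its `(i,k)`-th `s × q` block is the Fourier coefficient `t_{i-k}(f)`. -/
noncomputable def blockToeplitz {s q : ℕ} (n : ℕ) (f : ℝ → Matrix (Fin s) (Fin q) ℂ) :
    Matrix (Fin n × Fin s) (Fin n × Fin q) ℂ :=
  fun ia kb => fourierCoeffM f ((ia.1 : ℤ) - (kb.1 : ℤ)) ia.2 kb.2

/-- The (real) eigenvalues of a Hermitian complex matrix; defined to be `0` on
non-Hermitian matrices. -/
noncomputable def hermEig {n : Type*} [Fintype n] [DecidableEq n] (A : Matrix n n ℂ) :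
    n → ℝ := by
  classical exact dite A.IsHermitian (fun h => h.eigenvalues) (fun _ => 0)

namespace BlockToeplitz

section LinearAlgebra

open scoped Matrix.Norms.L2Operator

variable {m n : Type*} [Fintype m] [Fintype n] [DecidableEq m] [DecidableEq n]

/-- The numerical range of `M` lies in the half-plane `Re z ≥ δ`. -/
def Coercive (δ : ℝ) (M : Matrix m m ℂ) : Prop :=
  ∀ x : m → ℂ, δ * ∑ i, ‖x i‖ ^ 2 ≤ (star x ⬝ᵥ (M *ᵥ x)).re

omit [DecidableEq m] in
lemma star_dotProduct_self_re (x : m → ℂ) : (star x ⬝ᵥ x).re = ∑ i, ‖x i‖ ^ 2 := by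
  simp [dotProduct, Complex.sq_norm, Complex.normSq_apply]

omit [DecidableEq m] in
lemma norm_star_dotProduct_le (x y : m → ℂ) :
    ‖star x ⬝ᵥ y‖ ≤ ‖WithLp.toLp 2 x‖ * ‖WithLp.toLp 2 y‖ := by
  have := norm_inner_le_norm (𝕜 := ℂ) (WithLp.toLp 2 x) (WithLp.toLp 2 y)
  rwa [EuclideanSpace.inner_eq_star_dotProduct, dotProduct_comm] at this

omit [DecidableEq m] in
lemma norm_toLp_sq (x : m → ℂ) : ‖WithLp.toLp 2 x‖ ^ 2 = ∑ i, ‖x i‖ ^ 2 := by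
  rw [EuclideanSpace.norm_sq_eq]

omit [DecidableEq m] in
lemma Coercive.norm_le {δ : ℝ} {M : Matrix m m ℂ} (hM : Coercive δ M) (x : m → ℂ) :
    δ * ‖WithLp.toLp 2 x‖ ≤ ‖WithLp.toLp 2 (M *ᵥ x)‖ := by
  rcases (norm_nonneg (WithLp.toLp 2 x)).eq_or_lt with h0 | h0
  · rw [← h0]; simp
  · have h1 := hM x
    rw [← norm_toLp_sq] at h1
    have h2 := (Complex.re_le_norm _).trans (norm_star_dotProduct_le x (M *ᵥ x))
    nlinarith

lemma Coercive.isUnit {δ : ℝ} (hδ : 0 < δ) {M : Matrix m m ℂ} (hM : Coercive δ M) :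
    IsUnit M := by
  rw [← mulVec_injective_iff_isUnit]
  intro x y hxy
  have h := hM.norm_le (x - y)
  simp only [mulVec_sub] at h
  rw [hxy, sub_self, WithLp.toLp_zero, norm_zero] at h
  have h0 : ‖WithLp.toLp 2 (x - y)‖ = 0 :=
    le_antisymm (by nlinarith [norm_nonneg (WithLp.toLp 2 (x - y))]) (norm_nonneg _)
  rw [norm_eq_zero, WithLp.toLp_eq_zero] at h0
  exact sub_eq_zero.1 h0

omit [DecidableEq m] in
lemma l2_opNorm_le_of_mulVec {A : Matrix m n ℂ} {c : ℝ} (hc : 0 ≤ c)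
    (h : ∀ x : n → ℂ, ‖WithLp.toLp 2 (A *ᵥ x)‖ ≤ c * ‖WithLp.toLp 2 x‖) : ‖A‖ ≤ c := by
  rw [l2_opNorm_def]
  exact ContinuousLinearMap.opNorm_le_bound _ hc fun x => h x.ofLp

lemma Coercive.norm_inv_le {δ : ℝ} (hδ : 0 < δ) {M : Matrix m m ℂ} (hM : Coercive δ M) :
    ‖M⁻¹‖ ≤ δ⁻¹ := by
  have hu := (isUnit_iff_isUnit_det M).1 (hM.isUnit hδ)
  refine l2_opNorm_le_of_mulVec (inv_nonneg.2 hδ.le) fun x => ?_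
  have h := hM.norm_le (M⁻¹ *ᵥ x)
  rw [mulVec_mulVec, mul_nonsing_inv M hu, one_mulVec] at h
  rwa [inv_mul_eq_div, le_div_iff₀' hδ]

omit [DecidableEq m] in
lemma norm_entry_le_l2_opNorm (A : Matrix m n ℂ) (i : m) (j : n) : ‖A i j‖ ≤ ‖A‖ := by
  have h := l2_opNorm_mulVec A (EuclideanSpace.single j 1)
  rw [PiLp.norm_single, norm_one, mul_one] at h
  refine le_trans ?_ h
  have h2 := PiLp.norm_apply_le (WithLp.toLp 2 (A *ᵥ (EuclideanSpace.single j (1 : ℂ)).ofLp)) i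
  simpa using h2

omit [DecidableEq m] in
lemma l2_opNorm_sq_le_sum (A : Matrix m n ℂ) : ‖A‖ ^ 2 ≤ ∑ i, ∑ j, ‖A i j‖ ^ 2 := by
  have h0 : 0 ≤ ∑ i, ∑ j, ‖A i j‖ ^ 2 := by positivity
  have h : ‖A‖ ≤ √(∑ i, ∑ j, ‖A i j‖ ^ 2) := by
    refine l2_opNorm_le_of_mulVec (Real.sqrt_nonneg _) fun x => ?_
    refine le_of_sq_le_sq ?_ (by positivity)
    rw [mul_pow, Real.sq_sqrt h0, norm_toLp_sq, norm_toLp_sq, Finset.sum_mul]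
    refine Finset.sum_le_sum fun i _ => ?_
    calc ‖(A *ᵥ x) i‖ ^ 2 ≤ (∑ j, ‖A i j‖ * ‖x j‖) ^ 2 := by
          gcongr
          refine (norm_sum_le _ _).trans ?_
          simp
      _ ≤ _ := Finset.sum_mul_sq_le_sq_mul_sq _ _ _
  calc ‖A‖ ^ 2 ≤ √(∑ i, ∑ j, ‖A i j‖ ^ 2) ^ 2 := by gcongr
    _ = _ := Real.sq_sqrt h0

omit [DecidableEq m] in
lemma norm_trace_mul_le (A : Matrix m n ℂ) (B : Matrix n m ℂ) :
    ‖(A * B).trace‖ ≤ ‖A‖ * ∑ i, ∑ j, ‖B i j‖ := by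
  rw [trace_mul_comm, Finset.mul_sum]
  refine (norm_sum_le _ _).trans (Finset.sum_le_sum fun i _ => ?_)
  rw [diag_apply, mul_apply, Finset.mul_sum]
  refine (norm_sum_le _ _).trans (Finset.sum_le_sum fun j _ => ?_)
  rw [norm_mul, mul_comm]
  gcongr
  exact norm_entry_le_l2_opNorm _ _ _

lemma norm_trace_le (A : Matrix m m ℂ) : ‖A.trace‖ ≤ Fintype.card m * ‖A‖ := by
  refine (norm_sum_le _ _).trans ?_
  refine (Finset.sum_le_sum fun i _ => norm_entry_le_l2_opNorm A i i).trans ?_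
  simp

lemma inv_sub_inv_eq {A B : Matrix m m ℂ} (hA : IsUnit A) (hB : IsUnit B) :
    A⁻¹ - B⁻¹ = A⁻¹ * (B - A) * B⁻¹ := by
  rw [isUnit_iff_isUnit_det] at hA hB
  rw [mul_sub, sub_mul, nonsing_inv_mul A hA, one_mul, mul_assoc, mul_nonsing_inv B hB, mul_one]

end LinearAlgebra

section Resolvent

variable {m n : Type*} [Fintype m] [Fintype n] [DecidableEq m] [DecidableEq n]

lemma toBlocks₁₁_inv {P : Matrix m m ℂ} {B : Matrix m n ℂ} {C : Matrix n m ℂ}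
    {D : Matrix n n ℂ} (hM : IsUnit (fromBlocks P B C D)) (hD : IsUnit D) :
    (fromBlocks P B C D)⁻¹.toBlocks₁₁ = (P - B * D⁻¹ * C)⁻¹ := by
  rw [isUnit_iff_isUnit_det] at hM hD
  have h := mul_nonsing_inv _ hM
  set N := (fromBlocks P B C D)⁻¹
  rw [← fromBlocks_toBlocks N, fromBlocks_multiply, ← fromBlocks_one, fromBlocks_inj] at h
  obtain ⟨h1, -, h2, -⟩ := h
  refine (inv_eq_right_inv ?_).symm
  have h3 : N.toBlocks₂₁ = -(D⁻¹ * C * N.toBlocks₁₁) := by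
    rw [eq_neg_iff_add_eq_zero, add_comm, Matrix.mul_assoc,
      ← nonsing_inv_mul_cancel_left (A := D) N.toBlocks₂₁ hD, ← Matrix.mul_add, h2,
      Matrix.mul_zero]
  rw [← h1, h3, Matrix.sub_mul, Matrix.mul_neg, ← sub_eq_add_neg]
  simp only [Matrix.mul_assoc]

open scoped MatrixOrder Matrix.Norms.L2Operator in
/-- The trace of a product of two positive semidefinite matrices is nonnegative. -/
lemma trace_mul_nonneg_of_posSemidef {A B : Matrix m m ℂ} (hA : A.PosSemidef)
    (hB : B.PosSemidef) : 0 ≤ (A * B).trace := by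
  obtain ⟨K, rfl⟩ := CStarAlgebra.nonneg_iff_eq_star_mul_self.1 hA.nonneg
  rw [mul_assoc, trace_mul_comm]
  exact (hB.mul_mul_conjTranspose_same K).trace_nonneg

lemma posSemidef_inv_sub_inv {X Y : Matrix m m ℂ} (hX : X.PosDef) (hY : Y.PosDef)
    (h : (Y - X).PosSemidef) : (X⁻¹ - Y⁻¹).PosSemidef := by
  have hXu := (isUnit_iff_isUnit_det X).1 hX.isUnit
  have hYu := (isUnit_iff_isUnit_det Y).1 hY.isUnit
  have key : X⁻¹ - Y⁻¹ = (X⁻¹ - Y⁻¹)ᴴ * X * (X⁻¹ - Y⁻¹) + (Y⁻¹)ᴴ * (Y - X) * Y⁻¹ := by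
    rw [conjTranspose_sub, hX.inv.isHermitian.eq, hY.inv.isHermitian.eq]
    simp only [sub_mul, mul_sub, nonsing_inv_mul X hXu, nonsing_inv_mul Y hYu, one_mul, mul_assoc,
      mul_nonsing_inv X hXu, mul_one]
    abel
  rw [key]
  exact (hX.posSemidef.conjTranspose_mul_mul_same _).add (h.conjTranspose_mul_mul_same _)

omit [Fintype m] in
lemma posDef_real_smul_one {t : ℝ} (ht : 0 < t) : ((t : ℂ) • (1 : Matrix m m ℂ)).PosDef :=
  PosDef.one.smul (by exact_mod_cast ht)

/-- The resolvent `(t + B G⁻¹ Bᴴ)⁻¹`. -/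
noncomputable def schurResolvent (t : ℝ) (B : Matrix m n ℂ) (G : Matrix n n ℂ) : Matrix m m ℂ :=
  ((t : ℂ) • (1 : Matrix m m ℂ) + B * G⁻¹ * Bᴴ)⁻¹

lemma schurResolvent_eq {t : ℝ} (ht : 0 < t) (B : Matrix m n ℂ) {G : Matrix n n ℂ}
    (hG : G.PosDef) :
    schurResolvent t B G = (t : ℂ)⁻¹ • (1 - B * ((t : ℂ) • G + Bᴴ * B)⁻¹ * Bᴴ) := by
  have hGu := (isUnit_iff_isUnit_det G).1 hG.isUnit
  have htc : (t : ℂ) ≠ 0 := by exact_mod_cast ht.ne'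
  have hH : ((t : ℂ) • G + Bᴴ * B).PosDef :=
    (hG.smul (by exact_mod_cast ht)).add_posSemidef (posSemidef_conjTranspose_mul_self B)
  have hHu := (isUnit_iff_isUnit_det _).1 hH.isUnit
  refine inv_eq_right_inv ?_
  set H := (t : ℂ) • G + Bᴴ * B with hHdef
  have h1 : ((t : ℂ) • (1 : Matrix m m ℂ) + B * G⁻¹ * Bᴴ) * B = B * G⁻¹ * H := by
    rw [hHdef, Matrix.add_mul, Matrix.mul_add, Matrix.mul_smul,
      nonsing_inv_mul_cancel_right _ _ hGu]
    simp only [Matrix.smul_mul, Matrix.one_mul, Matrix.mul_assoc]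
  rw [mul_smul_comm, mul_sub, mul_one, ← Matrix.mul_assoc, ← Matrix.mul_assoc, h1,
    mul_nonsing_inv_cancel_right _ _ hHu, add_sub_cancel_right, smul_smul, inv_mul_cancel₀ htc,
    one_smul]

/-- Shifting `G` by `ε` changes the trace of the resolvent by at most `t⁻¹ tr (ε (G + ε)⁻¹)`. -/
lemma abs_trace_schurResolvent_sub_le {t ε : ℝ} (ht : 0 < t) (hε : 0 < ε) (B : Matrix m n ℂ)
    {G : Matrix n n ℂ} (hG : G.PosDef) :
    |(schurResolvent t B (G + (ε : ℂ) • 1)).trace.re - (schurResolvent t B G).trace.re| ≤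
      t⁻¹ * (ε * (G + (ε : ℂ) • 1)⁻¹.trace.re) := by
  have htc : (t : ℂ) ≠ 0 := by exact_mod_cast ht.ne'
  have htc' : (0 : ℂ) < t := by exact_mod_cast ht
  have hGε : (G + (ε : ℂ) • 1).PosDef := hG.add (posDef_real_smul_one hε)
  have hS := posSemidef_conjTranspose_mul_self B
  set S := Bᴴ * B
  have hH : ((t : ℂ) • G + S).PosDef := (hG.smul htc').add_posSemidef hS
  have hHε : ((t : ℂ) • (G + (ε : ℂ) • 1) + S).PosDef := (hGε.smul htc').add_posSemidef hS
  set H := (t : ℂ) • G + S with hHd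
  set Hε := (t : ℂ) • (G + (ε : ℂ) • 1) + S with hHεd
  have hsub : Hε - H = ((t * ε : ℝ) : ℂ) • 1 := by
    rw [hHd, hHεd, smul_add, smul_smul, add_sub_add_right_eq_sub, add_sub_cancel_left]
    push_cast; rfl
  have hD : (H⁻¹ - Hε⁻¹).PosSemidef := by
    refine posSemidef_inv_sub_inv hH hHε ?_
    rw [hsub]
    exact (posDef_real_smul_one (mul_pos ht hε)).posSemidef
  have htr : ∀ K : Matrix n n ℂ, (B * K * Bᴴ).trace = (K * S).trace := fun K => by
    rw [Matrix.mul_assoc, trace_mul_comm, Matrix.mul_assoc]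
  have e1 : (schurResolvent t B (G + (ε : ℂ) • 1)).trace - (schurResolvent t B G).trace
      = (t : ℂ)⁻¹ * ((H⁻¹ - Hε⁻¹) * S).trace := by
    rw [schurResolvent_eq ht B hG, schurResolvent_eq ht B hGε, trace_smul, trace_smul,
      trace_sub, trace_sub, htr, htr, sub_mul, trace_sub]
    simp only [smul_eq_mul]
    ring
  have l0 : 0 ≤ ((H⁻¹ - Hε⁻¹) * S).trace := trace_mul_nonneg_of_posSemidef hD hS
  have l1 : ((H⁻¹ - Hε⁻¹) * S).trace ≤ ((H⁻¹ - Hε⁻¹) * H).trace := by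
    rw [← sub_nonneg, ← trace_sub, ← mul_sub]
    refine trace_mul_nonneg_of_posSemidef hD ?_
    rw [hHd, add_sub_cancel_right]
    exact (hG.smul htc').posSemidef
  have l2 : ((H⁻¹ - Hε⁻¹) * H).trace = ((t * ε : ℝ) : ℂ) * Hε⁻¹.trace := by
    have hHu := (isUnit_iff_isUnit_det _).1 hH.isUnit
    have hHεu := (isUnit_iff_isUnit_det _).1 hHε.isUnit
    rw [sub_mul, nonsing_inv_mul _ hHu, ← nonsing_inv_mul _ hHεu, ← mul_sub, hsub,
      mul_smul_comm, mul_one, trace_smul, smul_eq_mul]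
  have l3 : Hε⁻¹.trace ≤ (t : ℂ)⁻¹ * (G + (ε : ℂ) • 1)⁻¹.trace := by
    have h := (posSemidef_inv_sub_inv (hGε.smul htc') hHε
      (by rw [hHεd, add_sub_cancel_left]; exact hS)).trace_nonneg
    have hinv : ((t : ℂ) • (G + (ε : ℂ) • 1))⁻¹ = (t : ℂ)⁻¹ • (G + (ε : ℂ) • 1)⁻¹ := by
      have := inv_smul' (G + (ε : ℂ) • 1) (Units.mk0 (t : ℂ) htc)
        ((isUnit_iff_isUnit_det _).1 hGε.isUnit)
      simpa [Units.smul_def] using this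
    rw [trace_sub, hinv, trace_smul, smul_eq_mul] at h
    exact sub_nonneg.1 h
  rw [← Complex.sub_re, e1, ← Complex.ofReal_inv, Complex.re_ofReal_mul, abs_mul,
    abs_of_pos (inv_pos.2 ht)]
  refine mul_le_mul_of_nonneg_left ?_ (inv_pos.2 ht).le
  rw [abs_of_nonneg (Complex.le_def.1 l0).1]
  refine ((Complex.le_def.1 l1).1).trans ?_
  rw [l2, Complex.re_ofReal_mul]
  have h3 := (Complex.le_def.1 l3).1
  rw [← Complex.ofReal_inv, Complex.re_ofReal_mul] at h3
  calc t * ε * Hε⁻¹.trace.re ≤ t * ε * (t⁻¹ * (G + (ε : ℂ) • 1)⁻¹.trace.re) := by gcongr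
    _ = _ := by field_simp

lemma trace_resolvent_eq_sum {A : Matrix m m ℂ} (hA : A.PosSemidef) {t : ℝ} (ht : 0 < t) :
    (((t : ℂ) • (1 : Matrix m m ℂ) + A)⁻¹).trace.re = ∑ i, (t + hermEig A i)⁻¹ := by
  have hE : hermEig A = hA.isHermitian.eigenvalues := by
    simp [hermEig, hA.isHermitian]
  rw [hE]
  have hs := hA.isHermitian.spectral_theorem
  rw [Unitary.conjStarAlgAut_apply] at hs
  set U := hA.isHermitian.eigenvectorUnitary
  set l := hA.isHermitian.eigenvalues with hl
  have hl0 : ∀ i, 0 ≤ l i := hA.eigenvalues_nonneg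
  have hU1 : (U : Matrix m m ℂ) * star (U : Matrix m m ℂ) = 1 := Unitary.coe_mul_star_self U
  have hU2 : star (U : Matrix m m ℂ) * (U : Matrix m m ℂ) = 1 := Unitary.coe_star_mul_self U
  have h1 : (t : ℂ) • (1 : Matrix m m ℂ) + A
      = U * diagonal (fun i => ((t + l i : ℝ) : ℂ)) * star (U : Matrix m m ℂ) := by
    have : diagonal (fun i => ((t + l i : ℝ) : ℂ))
        = (t : ℂ) • (1 : Matrix m m ℂ) + diagonal (RCLike.ofReal ∘ l) := by
      rw [smul_one_eq_diagonal, diagonal_add]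
      congr 1; ext i; simp
    rw [this, mul_add, add_mul, ← hs, mul_smul_comm, mul_one, smul_mul_assoc, hU1]
  have h2 : ((t : ℂ) • (1 : Matrix m m ℂ) + A)⁻¹
      = U * diagonal (fun i => (((t + l i)⁻¹ : ℝ) : ℂ)) * star (U : Matrix m m ℂ) := by
    refine inv_eq_right_inv ?_
    rw [h1]
    calc _ = (U : Matrix m m ℂ) * (diagonal (fun i => ((t + l i : ℝ) : ℂ)) *
          (star (U : Matrix m m ℂ) * U) * diagonal (fun i => (((t + l i)⁻¹ : ℝ) : ℂ))) *
            star (U : Matrix m m ℂ) := by simp only [mul_assoc]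
      _ = 1 := by
        rw [hU2, mul_one, diagonal_mul_diagonal]
        have : (fun i => ((t + l i : ℝ) : ℂ) * (((t + l i)⁻¹ : ℝ) : ℂ)) = fun _ => 1 := by
          ext i
          rw [← Complex.ofReal_mul, mul_inv_cancel₀ (by linarith [hl0 i]), Complex.ofReal_one]
        rw [this, diagonal_one, mul_one, hU1]
  rw [h2, trace_mul_comm, ← mul_assoc, hU2, one_mul, trace_diagonal, ← Complex.ofReal_sum,
    Complex.ofReal_re]

lemma hermEig_nonneg {A : Matrix m m ℂ} (hA : A.PosSemidef) (i : m) : 0 ≤ hermEig A i := by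
  have hE : hermEig A = hA.isHermitian.eigenvalues := by
    simp [hermEig, hA.isHermitian]
  rw [hE]
  exact hA.eigenvalues_nonneg i

omit [DecidableEq m] in
lemma posSemidef_mul_inv_mul (B : Matrix m n ℂ) {G : Matrix n n ℂ} (hG : G.PosDef) :
    (B * G⁻¹ * Bᴴ).PosSemidef :=
  hG.inv.posSemidef.mul_mul_conjTranspose_same B

/-- `[[t, B], [-Bᴴ, G + ε]]` is coercive. -/
lemma coercive_fromBlocks {t ε δ : ℝ} (ht : δ ≤ t) (hε : δ ≤ ε) (B : Matrix m n ℂ)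
    {G : Matrix n n ℂ} (hG : G.PosSemidef) :
    Coercive δ (fromBlocks ((t : ℂ) • 1) B (-Bᴴ) (G + (ε : ℂ) • 1)) := by
  intro x
  obtain ⟨u, v, rfl⟩ : ∃ u v, x = Sum.elim u v := ⟨x ∘ Sum.inl, x ∘ Sum.inr, by simp⟩
  have h1 : star v ⬝ᵥ (Bᴴ *ᵥ u) = star (star u ⬝ᵥ (B *ᵥ v)) := by
    rw [← star_dotProduct_star, star_mulVec, star_star, dotProduct_mulVec, dotProduct_comm]
  have h2 := (Complex.le_def.1 (hG.dotProduct_mulVec_nonneg v)).1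
  have hs : star (Sum.elim u v) = Sum.elim (star u) (star v) := by
    ext i; cases i <;> rfl
  rw [fromBlocks_mulVec, hs, sumElim_dotProduct_sumElim, Fintype.sum_sum_type]
  simp only [Function.comp_def, Sum.elim_inl, Sum.elim_inr, add_mulVec, smul_mulVec,
    one_mulVec, neg_mulVec, dotProduct_add, dotProduct_neg, dotProduct_smul, smul_eq_mul]
  rw [h1]
  have h3 := star_dotProduct_self_re u
  have h4 := star_dotProduct_self_re v
  have h5 : 0 ≤ ∑ i, ‖u i‖ ^ 2 := by positivity
  have h6 : 0 ≤ ∑ i, ‖v i‖ ^ 2 := by positivity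
  simp only [Complex.zero_re] at h2
  simp only [Complex.add_re, Complex.neg_re, Complex.star_def, Complex.conj_re,
    Complex.re_ofReal_mul, h3, h4]
  nlinarith

end Resolvent

section Toeplitz

/-- Normalized Lebesgue measure on `(-π, π]`. -/
noncomputable def circ : Measure ℝ :=
  ENNReal.ofReal (2 * Real.pi)⁻¹ • volume.restrict (Set.Ioc (-Real.pi) Real.pi)

instance : IsProbabilityMeasure circ := by
  constructor
  have h : (0 : ℝ) < 2 * Real.pi := by positivity
  rw [circ, Measure.smul_apply, Measure.restrict_apply_univ, Real.volume_Ioc, smul_eq_mul,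
    ← ENNReal.ofReal_mul (inv_nonneg.2 h.le), show Real.pi - -Real.pi = 2 * Real.pi by ring,
    inv_mul_cancel₀ h.ne', ENNReal.ofReal_one]

lemma integral_circ {E : Type*} [NormedAddCommGroup E] [NormedSpace ℝ E] (f : ℝ → E) :
    ∫ θ, f θ ∂circ = (2 * Real.pi)⁻¹ • ∫ θ in (-Real.pi)..Real.pi, f θ := by
  rw [circ, integral_smul_measure, intervalIntegral.integral_of_le (by linarith [Real.pi_pos]),
    ENNReal.toReal_ofReal (by positivity)]

lemma integrable_circ {f : ℝ → ℂ} (hf : IntervalIntegrable f volume (-Real.pi) Real.pi) :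
    Integrable f circ := by
  rw [intervalIntegrable_iff_integrableOn_Ioc_of_le (by linarith [Real.pi_pos])] at hf
  exact hf.smul_measure ENNReal.ofReal_ne_top

lemma circ_absolutelyContinuous :
    circ ≪ volume.restrict (Set.Icc (-Real.pi) Real.pi) :=
  (Measure.smul_absolutelyContinuous).trans
    (Measure.restrict_mono Set.Ioc_subset_Icc_self le_rfl).absolutelyContinuous

/-- The character `θ ↦ exp (-i k θ)`. -/
noncomputable def chr (k : ℤ) (θ : ℝ) : ℂ := Complex.exp (-Complex.I * (k : ℂ) * (θ : ℂ))

lemma chr_add (k l : ℤ) (θ : ℝ) : chr (k + l) θ = chr k θ * chr l θ := by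
  rw [chr, chr, chr, ← Complex.exp_add]
  congr 1
  push_cast
  ring

@[simp] lemma chr_zero (θ : ℝ) : chr 0 θ = 1 := by simp [chr]

lemma star_chr (k : ℤ) (θ : ℝ) : star (chr k θ) = chr (-k) θ := by
  rw [chr, chr, Complex.star_def, ← Complex.exp_conj]
  simp

@[simp] lemma norm_chr (k : ℤ) (θ : ℝ) : ‖chr k θ‖ = 1 := by
  rw [chr, Complex.norm_exp]
  simp

lemma continuous_chr (k : ℤ) : Continuous (chr k) := by
  unfold chr
  fun_prop

lemma integral_chr (k : ℤ) : ∫ θ, chr k θ ∂circ = if k = 0 then 1 else 0 := by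
  split_ifs with h
  · simp [h]
  · have hc : -Complex.I * (k : ℂ) ≠ 0 := by simp [h]
    rw [integral_circ]
    simp only [chr]
    rw [integral_exp_mul_complex hc]
    have : Complex.exp (-Complex.I * k * (Real.pi : ℝ))
        = Complex.exp (-Complex.I * k * ((-Real.pi : ℝ) : ℂ)) := by
      rw [Complex.exp_eq_exp_iff_exists_int]
      refine ⟨-k, ?_⟩
      push_cast
      ring
    rw [this]
    simp

lemma integrable_mul_chr {f : ℝ → ℂ} (hf : Integrable f circ) (k : ℤ) :
    Integrable (fun θ => f θ * chr k θ) circ :=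
  hf.mul_bdd (c := 1) (continuous_chr k).aestronglyMeasurable (by simp)

variable {ι κ : Type*}

/-- The block Toeplitz matrix over arbitrary index types. -/
noncomputable def toep (n : ℕ) (h : ℝ → Matrix ι κ ℂ) : Matrix (Fin n × ι) (Fin n × κ) ℂ :=
  fun p r => ∫ θ, h θ p.2 r.2 * chr ((p.1 : ℤ) - (r.1 : ℤ)) θ ∂circ

lemma blockToeplitz_eq_toep {s q : ℕ} (n : ℕ) (f : ℝ → Matrix (Fin s) (Fin q) ℂ) :
    blockToeplitz n f = toep n f := by
  ext p r
  rw [blockToeplitz, toep, fourierCoeffM, of_apply, integral_circ, Complex.real_smul]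
  simp only [chr, one_div, Complex.ofReal_inv, Complex.ofReal_mul, Complex.ofReal_ofNat]

lemma toep_conjTranspose (n : ℕ) (h : ℝ → Matrix ι κ ℂ) :
    toep n (fun θ => (h θ)ᴴ) = (toep n h)ᴴ := by
  ext p r
  rw [conjTranspose_apply, toep, toep, Complex.star_def, ← integral_conj]
  congr 1 with θ
  rw [← Complex.star_def, star_mul', star_chr, conjTranspose_apply, neg_sub]

lemma toep_neg (n : ℕ) (h : ℝ → Matrix ι κ ℂ) : toep n (fun θ => -h θ) = -toep n h := by
  ext p r
  simp [toep, integral_neg]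

lemma toep_add (n : ℕ) {h k : ℝ → Matrix ι κ ℂ} (hh : ∀ a b, Integrable (fun θ => h θ a b) circ)
    (hk : ∀ a b, Integrable (fun θ => k θ a b) circ) :
    toep n (fun θ => h θ + k θ) = toep n h + toep n k := by
  ext p r
  rw [Matrix.add_apply, toep, toep, toep, ← integral_add (integrable_mul_chr (hh _ _) _)
    (integrable_mul_chr (hk _ _) _)]
  simp only [Matrix.add_apply, add_mul]

lemma toep_sub (n : ℕ) {h k : ℝ → Matrix ι κ ℂ} (hh : ∀ a b, Integrable (fun θ => h θ a b) circ)
    (hk : ∀ a b, Integrable (fun θ => k θ a b) circ) :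
    toep n (fun θ => h θ - k θ) = toep n h - toep n k := by
  ext p r
  rw [Matrix.sub_apply, toep, toep, toep, ← integral_sub (integrable_mul_chr (hh _ _) _)
    (integrable_mul_chr (hk _ _) _)]
  simp only [Matrix.sub_apply, sub_mul]

lemma toep_smul_one [DecidableEq ι] (n : ℕ) (c : ℂ) :
    toep n (fun _ => c • (1 : Matrix ι ι ℂ)) = c • 1 := by
  ext p r
  rw [toep, integral_const_mul, integral_chr]
  simp only [Matrix.smul_apply, Matrix.one_apply, sub_eq_zero, Nat.cast_inj, Fin.val_inj,
    Prod.ext_iff, smul_eq_mul]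
  split_ifs <;> simp_all

lemma toep_fromBlocks {ι' κ' : Type*} (n : ℕ) (A : ℝ → Matrix ι κ ℂ) (B : ℝ → Matrix ι κ' ℂ)
    (C : ℝ → Matrix ι' κ ℂ) (D : ℝ → Matrix ι' κ' ℂ) :
    (toep n (fun θ => fromBlocks (A θ) (B θ) (C θ) (D θ))).submatrix
      (Equiv.prodSumDistrib (Fin n) ι ι').symm (Equiv.prodSumDistrib (Fin n) κ κ').symm =
      fromBlocks (toep n A) (toep n B) (toep n C) (toep n D) := by
  ext p r
  rcases p with p | p <;> rcases r with r | r <;> rfl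

section Vand

variable [DecidableEq ι] [DecidableEq κ]

/-- The block Vandermonde column with blocks `exp (-i k θ) • 1`, `k < n`. -/
noncomputable def vand (ι : Type*) [DecidableEq ι] (n : ℕ) (θ : ℝ) :
    Matrix (Fin n × ι) ι ℂ :=
  fun p b => if p.2 = b then chr p.1 θ else 0

variable [Fintype ι] [Fintype κ]

lemma vand_mul_apply {l : Type*} (n : ℕ) (θ : ℝ) (A : Matrix ι l ℂ) (p : Fin n × ι) (b : l) :
    (vand ι n θ * A) p b = chr p.1 θ * A p.2 b := by
  simp [vand, mul_apply]

lemma vand_conjTranspose_mul_self (n : ℕ) (θ : ℝ) :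
    (vand ι n θ)ᴴ * vand ι n θ = (n : ℂ) • 1 := by
  ext a b
  simp only [mul_apply, conjTranspose_apply, vand, Fintype.sum_prod_type, Matrix.smul_apply,
    Matrix.one_apply, smul_eq_mul]
  have : ∀ x : Fin n, (starRingEnd ℂ) (chr x θ) * chr x θ = 1 := fun x => by
    rw [← Complex.star_def, star_chr, ← chr_add, neg_add_cancel, chr_zero]
  by_cases hab : a = b
  · subst hab
    simp [apply_ite star, this]
  · simp [apply_ite star, hab, Ne.symm hab]

lemma vand_mul_mul_apply (n : ℕ) (θ : ℝ) (A : Matrix ι κ ℂ) (p : Fin n × ι) (r : Fin n × κ) :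
    (vand ι n θ * A * (vand κ n θ)ᴴ) p r = A p.2 r.2 * chr ((p.1 : ℤ) - (r.1 : ℤ)) θ := by
  rw [mul_apply]
  simp only [vand_mul_apply, conjTranspose_apply, vand, apply_ite star, star_zero, mul_ite,
    mul_zero, Finset.sum_ite_eq, Finset.mem_univ, if_true, star_chr]
  rw [sub_eq_add_neg, chr_add]
  ring

lemma sum_mul_toep (n : ℕ) {h : ℝ → Matrix ι κ ℂ}
    (hh : ∀ a b, Integrable (fun θ => h θ a b) circ)
    (c : Fin n × ι → Fin n × κ → ℂ) :
    Integrable (fun θ => ∑ p, ∑ r, c p r * (vand ι n θ * h θ * (vand κ n θ)ᴴ) p r) circ ∧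
    ∑ p, ∑ r, c p r * toep n h p r =
      ∫ θ, ∑ p, ∑ r, c p r * (vand ι n θ * h θ * (vand κ n θ)ᴴ) p r ∂circ := by
  have hi : ∀ p r, Integrable
      (fun θ => c p r * (vand ι n θ * h θ * (vand κ n θ)ᴴ) p r) circ := fun p r => by
    simp only [vand_mul_mul_apply]
    exact (integrable_mul_chr (hh _ _) _).const_mul _
  refine ⟨integrable_finsetSum _ fun p _ => integrable_finsetSum _ fun r _ => hi p r, ?_⟩
  rw [integral_finsetSum _ fun p _ => integrable_finsetSum _ fun r _ => hi p r]
  refine Finset.sum_congr rfl fun p _ => ?_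
  rw [integral_finsetSum _ fun r _ => hi p r]
  refine Finset.sum_congr rfl fun r _ => ?_
  rw [integral_const_mul]
  simp only [vand_mul_mul_apply, toep]

lemma trace_mul_eq_sum {m l : Type*} [Fintype m] [Fintype l] (X : Matrix l m ℂ)
    (A : Matrix m l ℂ) : (X * A).trace = ∑ p, ∑ r, X r p * A p r := by
  rw [Finset.sum_comm]
  rfl

lemma integrable_trace_mul_vand (n : ℕ) {h : ℝ → Matrix ι κ ℂ}
    (hh : ∀ a b, Integrable (fun θ => h θ a b) circ) (X : Matrix (Fin n × κ) (Fin n × ι) ℂ) :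
    Integrable (fun θ => (X * (vand ι n θ * h θ * (vand κ n θ)ᴴ)).trace) circ := by
  simp only [trace_mul_eq_sum]
  exact (sum_mul_toep n hh _).1

lemma trace_mul_toep (n : ℕ) {h : ℝ → Matrix ι κ ℂ}
    (hh : ∀ a b, Integrable (fun θ => h θ a b) circ) (X : Matrix (Fin n × κ) (Fin n × ι) ℂ) :
    (X * toep n h).trace =
      ∫ θ, (X * (vand ι n θ * h θ * (vand κ n θ)ᴴ)).trace ∂circ := by
  simp only [trace_mul_eq_sum]
  exact (sum_mul_toep n hh _).2

lemma dotProduct_mulVec_eq_trace {m : Type*} [Fintype m] (x : m → ℂ) (A : Matrix m m ℂ) :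
    star x ⬝ᵥ (A *ᵥ x) = (vecMulVec x (star x) * A).trace := by
  rw [vecMulVec_mul, trace_vecMulVec, dotProduct_mulVec, dotProduct_comm]

lemma dotProduct_vand_mulVec (n : ℕ) (θ : ℝ) (A : Matrix ι ι ℂ) (x : Fin n × ι → ℂ) :
    (vecMulVec x (star x) * (vand ι n θ * A * (vand ι n θ)ᴴ)).trace =
      star ((vand ι n θ)ᴴ *ᵥ x) ⬝ᵥ (A *ᵥ ((vand ι n θ)ᴴ *ᵥ x)) := by
  rw [← dotProduct_mulVec_eq_trace, star_mulVec, conjTranspose_conjTranspose,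
    ← dotProduct_mulVec, mulVec_mulVec, mulVec_mulVec, Matrix.mul_assoc]

lemma integrable_dotProduct_vand (n : ℕ) {h : ℝ → Matrix ι ι ℂ}
    (hh : ∀ a b, Integrable (fun θ => h θ a b) circ) (x : Fin n × ι → ℂ) :
    Integrable (fun θ =>
      star ((vand ι n θ)ᴴ *ᵥ x) ⬝ᵥ (h θ *ᵥ ((vand ι n θ)ᴴ *ᵥ x))) circ := by
  simp only [← dotProduct_vand_mulVec]
  exact integrable_trace_mul_vand n hh _

lemma dotProduct_toep_mulVec (n : ℕ) {h : ℝ → Matrix ι ι ℂ}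
    (hh : ∀ a b, Integrable (fun θ => h θ a b) circ) (x : Fin n × ι → ℂ) :
    star x ⬝ᵥ (toep n h *ᵥ x) =
      ∫ θ, star ((vand ι n θ)ᴴ *ᵥ x) ⬝ᵥ (h θ *ᵥ ((vand ι n θ)ᴴ *ᵥ x)) ∂circ := by
  simp only [← dotProduct_vand_mulVec]
  rw [dotProduct_mulVec_eq_trace, trace_mul_toep n hh]

omit [Fintype ι] in
lemma integrable_const_one : ∀ a b : ι,
    Integrable (fun _ : ℝ => (1 : Matrix ι ι ℂ) a b) circ := fun _ _ => integrable_const _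

omit [Fintype ι] in
lemma toep_one (n : ℕ) : toep n (fun _ => (1 : Matrix ι ι ℂ)) = 1 := by
  simpa using toep_smul_one (ι := ι) n 1

lemma integrable_sum_norm_sq_vand (n : ℕ) (x : Fin n × ι → ℂ) :
    Integrable (fun θ => ∑ a, ‖((vand ι n θ)ᴴ *ᵥ x) a‖ ^ 2) circ := by
  have := (integrable_dotProduct_vand n (integrable_const_one (ι := ι)) x).re
  simpa only [one_mulVec, star_dotProduct_self_re, RCLike.re_to_complex] using this

/-- Resolution of the identity. -/
lemma integral_sum_norm_sq_vand (n : ℕ) (x : Fin n × ι → ℂ) :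
    ∫ θ, ∑ a, ‖((vand ι n θ)ᴴ *ᵥ x) a‖ ^ 2 ∂circ = ∑ p, ‖x p‖ ^ 2 := by
  have h := dotProduct_toep_mulVec n (integrable_const_one (ι := ι)) x
  have h2 := integral_re (integrable_dotProduct_vand n (integrable_const_one (ι := ι)) x)
  rw [← h, toep_one, one_mulVec] at h2
  simpa only [one_mulVec, star_dotProduct_self_re, RCLike.re_to_complex] using h2

lemma coercive_toep {δ : ℝ} (n : ℕ) {h : ℝ → Matrix ι ι ℂ}
    (hh : ∀ a b, Integrable (fun θ => h θ a b) circ) (hc : ∀ᵐ θ ∂circ, Coercive δ (h θ)) :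
    Coercive δ (toep n h) := by
  intro x
  rw [dotProduct_toep_mulVec n hh, ← integral_sum_norm_sq_vand, ← integral_const_mul]
  have h2 := integral_re (integrable_dotProduct_vand n hh x)
  simp only [RCLike.re_to_complex] at h2
  rw [← h2]
  refine integral_mono_ae ((integrable_sum_norm_sq_vand n x).const_mul _)
    (integrable_dotProduct_vand n hh x).re ?_
  filter_upwards [hc] with θ hθ using hθ _

lemma posDef_toep (n : ℕ) {g : ℝ → Matrix ι ι ℂ}
    (hg : ∀ a b, Integrable (fun θ => g θ a b) circ) (hpd : ∀ᵐ θ ∂circ, (g θ).PosDef) :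
    (toep n g).PosDef := by
  have hH : (toep n g).IsHermitian := by
    rw [IsHermitian, ← toep_conjTranspose]
    ext p r
    refine integral_congr_ae ?_
    filter_upwards [hpd] with θ hθ
    rw [hθ.isHermitian.eq]
  refine PosDef.of_dotProduct_mulVec_pos hH fun x hx => ?_
  have hi := integrable_dotProduct_vand n hg x
  have h2 := integral_re hi
  rw [← dotProduct_toep_mulVec n hg x] at h2
  have him : (star x ⬝ᵥ (toep n g *ᵥ x)).im = 0 := hH.im_star_dotProduct_mulVec_self x
  rw [Complex.lt_def]
  refine ⟨?_, by simpa using him.symm⟩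
  simp only [RCLike.re_to_complex] at h2
  rw [Complex.zero_re, ← h2]
  have hnn : 0 ≤ᵐ[circ] fun θ =>
      (star ((vand ι n θ)ᴴ *ᵥ x) ⬝ᵥ (g θ *ᵥ ((vand ι n θ)ᴴ *ᵥ x))).re := by
    filter_upwards [hpd] with θ hθ using hθ.posSemidef.re_dotProduct_nonneg _
  refine lt_of_le_of_ne (integral_nonneg_of_ae hnn) fun h0 => hx ?_
  rw [eq_comm, integral_eq_zero_iff_of_nonneg_ae hnn hi.re] at h0
  have hz : ∀ᵐ θ ∂circ, ∑ a, ‖((vand ι n θ)ᴴ *ᵥ x) a‖ ^ 2 = 0 := by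
    filter_upwards [h0, hpd] with θ h1 hθ
    have : (vand ι n θ)ᴴ *ᵥ x = 0 := by
      by_contra hne
      exact (hθ.re_dotProduct_pos hne).ne' h1
    simp [this]
  have h3 := integral_sum_norm_sq_vand n x
  rw [integral_congr_ae hz, integral_zero, eq_comm,
    Finset.sum_eq_zero_iff_of_nonneg fun _ _ => by positivity] at h3
  ext p
  simpa using h3 p (Finset.mem_univ p)

end Vand

end Toeplitz

section SquareIntegrable

open scoped Topology

lemma restrict_eq_smul_circ :
    volume.restrict (Set.Ioc (-Real.pi) Real.pi) = ENNReal.ofReal (2 * Real.pi) • circ := by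
  have h : (0 : ℝ) < 2 * Real.pi := by positivity
  rw [circ, smul_smul, ← ENNReal.ofReal_mul h.le, mul_inv_cancel₀ h.ne', ENNReal.ofReal_one,
    one_smul]

/-- Scalar Fourier coefficients. -/
noncomputable def coeff (u : ℝ → ℂ) (m : ℤ) : ℂ := ∫ θ, u θ * chr m θ ∂circ

/-- Parseval's identity. -/
lemma hasSum_norm_sq_coeff {u : ℝ → ℂ} (hu : MemLp u 2 circ) :
    HasSum (fun m => ‖coeff u m‖ ^ 2) (∫ θ, ‖u θ‖ ^ 2 ∂circ) := by
  have hlt : -Real.pi < Real.pi := by linarith [Real.pi_pos]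
  have hu' : MemLp u 2 (volume.restrict (Set.Ioc (-Real.pi) Real.pi)) := by
    rw [restrict_eq_smul_circ]
    exact hu.smul_measure ENNReal.ofReal_ne_top
  have h := hasSum_sq_fourierCoeffOn hlt hu'
  have e : Real.pi - -Real.pi = 2 * Real.pi := by ring
  rw [integral_circ, ← e]
  refine h.congr_fun fun m => ?_
  rw [fourierCoeffOn_eq_integral, coeff, integral_circ, ← e, one_div]
  congr 4 with θ
  rw [fourier_coe_apply, smul_eq_mul, mul_comm, chr]
  congr 2
  have : (Real.pi : ℂ) ≠ 0 := by exact_mod_cast Real.pi_ne_zero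
  push_cast
  field_simp
  ring

/-- The squared `L²` distance of `u` to its partial Fourier sum over `S`. -/
noncomputable def defect (u : ℝ → ℂ) (S : Finset ℤ) : ℝ :=
  ∫ θ, ‖u θ - ∑ m ∈ S, coeff u m * chr (-m) θ‖ ^ 2 ∂circ

lemma memLp_trig (c : ℤ → ℂ) (S : Finset ℤ) :
    MemLp (fun θ => ∑ m ∈ S, c m * chr (-m) θ) 2 circ :=
  memLp_finsetSum _ fun m _ =>
    MemLp.of_bound (continuous_const.mul (continuous_chr _)).aestronglyMeasurable ‖c m‖
      (by simp)

lemma coeff_sub_trig {u : ℝ → ℂ} (hu : Integrable u circ) (S : Finset ℤ) {k : ℤ} (hk : k ∉ S) :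
    ∫ θ, (u θ - ∑ m ∈ S, coeff u m * chr (-m) θ) * chr k θ ∂circ = coeff u k := by
  have hi : ∀ m ∈ S, Integrable (fun θ => coeff u m * chr (-m + k) θ) circ := fun m _ =>
    Integrable.of_bound (continuous_const.mul (continuous_chr _)).aestronglyMeasurable
      ‖coeff u m‖ (by simp)
  simp only [sub_mul, Finset.sum_mul, mul_assoc, ← chr_add]
  rw [integral_sub (integrable_mul_chr hu k) (integrable_finsetSum _ hi),
    integral_finsetSum _ hi, Finset.sum_eq_zero, sub_zero, coeff]
  intro m hm
  rw [integral_const_mul, integral_chr, if_neg, mul_zero]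
  rintro h
  exact hk (by rwa [show k = m by omega])

lemma defect_eq {u : ℝ → ℂ} (hu : MemLp u 2 circ) (S : Finset ℤ) :
    defect u S = (∫ θ, ‖u θ‖ ^ 2 ∂circ) - ∑ m ∈ S, ‖coeff u m‖ ^ 2 := by
  classical
  induction S using Finset.induction_on with
  | empty => simp [defect]
  | insert k S hk ih =>
    have hr : MemLp (fun θ => u θ - ∑ m ∈ S, coeff u m * chr (-m) θ) 2 circ :=
      hu.sub (memLp_trig _ S)
    have hri : Integrable (fun θ => (u θ - ∑ m ∈ S, coeff u m * chr (-m) θ) * chr k θ) circ :=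
      integrable_mul_chr (hr.integrable one_le_two) k
    have hpt : ∀ θ, ‖u θ - ∑ m ∈ insert k S, coeff u m * chr (-m) θ‖ ^ 2 =
        ‖u θ - ∑ m ∈ S, coeff u m * chr (-m) θ‖ ^ 2 -
          2 * (star (coeff u k) * ((u θ - ∑ m ∈ S, coeff u m * chr (-m) θ) * chr k θ)).re +
          ‖coeff u k‖ ^ 2 := by
      intro θ
      rw [Finset.sum_insert hk, add_comm (coeff u k * _), ← sub_sub]
      set r := u θ - ∑ m ∈ S, coeff u m * chr (-m) θ
      have h1 := Complex.normSq_sub r (coeff u k * chr (-k) θ)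
      rw [Complex.normSq_eq_norm_sq, Complex.normSq_eq_norm_sq, Complex.normSq_eq_norm_sq,
        norm_mul, norm_chr, mul_one, map_mul, ← Complex.star_def,
        star_chr, neg_neg] at h1
      rw [h1, show r * (star (coeff u k) * chr k θ) = star (coeff u k) * (r * chr k θ) by ring]
      ring
    have hre := integral_re (hri.const_mul (star (coeff u k)))
    rw [integral_const_mul, coeff_sub_trig (hu.integrable one_le_two) S hk] at hre
    simp only [RCLike.re_to_complex] at hre
    have hre' : (star (coeff u k) * coeff u k).re = ‖coeff u k‖ ^ 2 := by
      rw [Complex.star_def, ← Complex.normSq_eq_conj_mul_self, Complex.ofReal_re,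
        Complex.normSq_eq_norm_sq]
    have hI1 := hr.integrable_norm_pow two_ne_zero
    have hI2 := ((hri.const_mul (star (coeff u k))).re).const_mul 2
    simp only [RCLike.re_to_complex] at hI2
    have hI3 : Integrable (fun θ => ‖u θ - ∑ m ∈ S, coeff u m * chr (-m) θ‖ ^ 2 -
        2 * (star (coeff u k) * ((u θ - ∑ m ∈ S, coeff u m * chr (-m) θ) * chr k θ)).re) circ :=
      hI1.sub hI2
    rw [Finset.sum_insert hk, defect]
    simp only [hpt]
    rw [integral_add hI3 (integrable_const _), integral_sub hI1 hI2,
      integral_const_mul, hre, hre']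
    rw [defect] at ih
    rw [ih]
    simp
    ring

lemma tendsto_defect {u : ℝ → ℂ} (hu : MemLp u 2 circ) :
    Tendsto (fun K : ℕ => defect u (Finset.Icc (-(K : ℤ)) K)) atTop (𝓝 0) := by
  simp only [defect_eq hu]
  rw [← sub_self (∫ θ, ‖u θ‖ ^ 2 ∂circ)]
  exact tendsto_const_nhds.sub
    ((hasSum_norm_sq_coeff hu).comp Finset.tendsto_Icc_neg)

lemma defect_nonneg (u : ℝ → ℂ) (S : Finset ℤ) : 0 ≤ defect u S :=
  integral_nonneg fun _ => by positivity

lemma defect_anti {u : ℝ → ℂ} (hu : MemLp u 2 circ) {S T : Finset ℤ} (h : S ⊆ T) :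
    defect u T ≤ defect u S := by
  rw [defect_eq hu, defect_eq hu]
  exact sub_le_sub_left (Finset.sum_le_sum_of_subset_of_nonneg h fun _ _ _ => by positivity) _

/-- The mean over the rows of an `n × n` Toeplitz matrix of the defects tends to zero. -/
lemma tendsto_mean_defect {u : ℝ → ℂ} (hu : MemLp u 2 circ) :
    Tendsto (fun n : ℕ => (n : ℝ)⁻¹ * ∑ i : Fin n, defect u
      (Finset.univ.image fun k : Fin n => (i : ℤ) - (k : ℤ))) atTop (𝓝 0) := by
  set b : ℕ → ℝ := fun K => defect u (Finset.Icc (-(K : ℤ)) K)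
  have hb0 : ∀ K, 0 ≤ b K := fun K => defect_nonneg _ _
  have hle : ∀ (n : ℕ) (i : Fin n), defect u
      (Finset.univ.image fun k : Fin n => (i : ℤ) - (k : ℤ)) ≤ b i + b (n - 1 - i) := by
    intro n i
    have hsub : ∀ K : ℕ, K ≤ i → K ≤ n - 1 - i → Finset.Icc (-(K : ℤ)) K ⊆
        Finset.univ.image fun k : Fin n => (i : ℤ) - (k : ℤ) := by
      intro K h1 h2 m hm
      rw [Finset.mem_Icc] at hm
      have := i.2
      rw [Finset.mem_image]
      refine ⟨⟨((i : ℤ) - m).toNat, by omega⟩, Finset.mem_univ _, ?_⟩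
      simp only []
      omega
    rcases le_total (i : ℕ) (n - 1 - i) with h | h
    · exact (defect_anti hu (hsub i le_rfl h)).trans (le_add_of_nonneg_right (hb0 _))
    · exact (defect_anti hu (hsub _ h le_rfl)).trans (le_add_of_nonneg_left (hb0 _))
  have hlim : Tendsto (fun n : ℕ => 2 * ((n : ℝ)⁻¹ * ∑ i ∈ Finset.range n, b i)) atTop (𝓝 0) := by
    simpa using (tendsto_defect hu).cesaro.const_mul 2
  refine squeeze_zero (fun n => mul_nonneg (by positivity)
    (Finset.sum_nonneg fun i _ => defect_nonneg _ _)) (fun n => ?_) hlim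
  have : ∑ i : Fin n, (b i + b (n - 1 - i)) = 2 * ∑ i ∈ Finset.range n, b i := by
    rw [Finset.sum_add_distrib, Fin.sum_univ_eq_sum_range (fun i => b i),
      Fin.sum_univ_eq_sum_range (fun i => b (n - 1 - i)), Finset.sum_range_reflect, two_mul]
  calc _ ≤ (n : ℝ)⁻¹ * ∑ i : Fin n, (b i + b (n - 1 - i)) := by
        gcongr with i _
        exact hle n i
    _ = _ := by rw [this]; ring

end SquareIntegrable

section Measurability

variable {α : Type*} {ι κ : Type*} [MeasurableSpace α] {μ : Measure α}

/-- A matrix-valued function with almost everywhere strongly measurable entries. -/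
def AEMeasEntries (h : α → Matrix ι κ ℂ) (μ : Measure α) : Prop :=
  ∀ a b, AEStronglyMeasurable (fun θ => h θ a b) μ

lemma AEMeasEntries.mul {l : Type*} [Fintype κ] {h : α → Matrix ι κ ℂ} {k : α → Matrix κ l ℂ}
    (hh : AEMeasEntries h μ) (hk : AEMeasEntries k μ) : AEMeasEntries (fun θ => h θ * k θ) μ :=
  fun a b => by
    simp only [mul_apply]
    exact Finset.aestronglyMeasurable_fun_sum _ fun c _ => (hh a c).mul (hk c b)

lemma AEMeasEntries.add {h k : α → Matrix ι κ ℂ}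
    (hh : AEMeasEntries h μ) (hk : AEMeasEntries k μ) : AEMeasEntries (fun θ => h θ + k θ) μ :=
  fun a b => (hh a b).add (hk a b)

lemma aeMeasEntries_const (A : Matrix ι κ ℂ) : AEMeasEntries (fun _ => A) μ :=
  fun _ _ => aestronglyMeasurable_const

lemma AEMeasEntries.conjTranspose {h : α → Matrix ι κ ℂ} (hh : AEMeasEntries h μ) :
    AEMeasEntries (fun θ => (h θ)ᴴ) μ := fun a b =>
  continuous_star.comp_aestronglyMeasurable (hh b a)

variable [Fintype ι] [DecidableEq ι]

omit [DecidableEq ι] in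
lemma AEMeasEntries.trace {h : α → Matrix ι ι ℂ} (hh : AEMeasEntries h μ) :
    AEStronglyMeasurable (fun θ => (h θ).trace) μ :=
  Finset.aestronglyMeasurable_fun_sum _ fun a _ => hh a a

lemma AEMeasEntries.det {h : α → Matrix ι ι ℂ} (hh : AEMeasEntries h μ) :
    AEStronglyMeasurable (fun θ => (h θ).det) μ := by
  simp only [det_apply]
  exact Finset.aestronglyMeasurable_fun_sum _ fun σ _ =>
    (Finset.aestronglyMeasurable_fun_prod _ fun i _ => hh _ _).const_smul _

lemma AEMeasEntries.inv {h : α → Matrix ι ι ℂ} (hh : AEMeasEntries h μ) :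
    AEMeasEntries (fun θ => (h θ)⁻¹) μ := fun a b => by
  simp only [inv_def, Matrix.smul_apply, Ring.inverse_eq_inv', adjugate_apply, smul_eq_mul]
  refine hh.det.aemeasurable.inv.aestronglyMeasurable.mul (AEMeasEntries.det fun i j => ?_)
  simp only [updateRow_apply]
  split_ifs
  · exact aestronglyMeasurable_const
  · exact hh _ _

end Measurability

section Bounded

open scoped Topology Matrix.Norms.L2Operator

variable {ι : Type*} [Fintype ι] [DecidableEq ι]

/-- The block diagonal weight with blocks `diagonal e`. -/
def weight (e : ι → ℂ) (n : ℕ) : Matrix (Fin n × ι) (Fin n × ι) ℂ := diagonal fun p => e p.2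

lemma norm_weight_le {e : ι → ℂ} (he : ∀ a, ‖e a‖ ≤ 1) (n : ℕ) : ‖weight e n‖ ≤ 1 := by
  rw [weight, l2_opNorm_diagonal]
  exact (pi_norm_le_iff_of_nonneg zero_le_one).2 fun p => he _

lemma norm_diagonal_le_one {e : ι → ℂ} (he : ∀ a, ‖e a‖ ≤ 1) :
    ‖(diagonal e : Matrix ι ι ℂ)‖ ≤ 1 := by
  rw [l2_opNorm_diagonal]
  exact (pi_norm_le_iff_of_nonneg zero_le_one).2 he

lemma norm_one_le : ‖(1 : Matrix ι ι ℂ)‖ ≤ 1 := by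
  rw [← diagonal_one]
  exact norm_diagonal_le_one (by simp)

lemma vand_conjTranspose_mul_weight (e : ι → ℂ) (n : ℕ) (θ : ℝ) :
    (vand ι n θ)ᴴ * weight e n = diagonal e * (vand ι n θ)ᴴ := by
  ext a p
  simp only [weight, mul_diagonal, diagonal_mul, conjTranspose_apply, vand]
  split_ifs with h
  · rw [h, mul_comm]
  · simp

lemma norm_vand_sq_le (n : ℕ) (θ : ℝ) : ‖vand ι n θ‖ ^ 2 ≤ n := by
  rw [sq, ← l2_opNorm_conjTranspose_mul_self, vand_conjTranspose_mul_self, norm_smul]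
  simpa using mul_le_mul_of_nonneg_left (norm_one_le (ι := ι)) (Nat.cast_nonneg n)

lemma norm_trace_vand_sub_le {δ η : ℝ} (hδ : 0 < δ) (hη : 0 < η) {n : ℕ} (hn : 0 < n) {e : ι → ℂ}
    (he : ∀ a, ‖e a‖ ≤ 1) {M : Matrix (Fin n × ι) (Fin n × ι) ℂ} {A : Matrix ι ι ℂ}
    (hM : Coercive δ M) (hA : Coercive δ A) (θ : ℝ) :
    ‖(n : ℂ)⁻¹ * (weight e n * M⁻¹ * (vand ι n θ * (1 : Matrix ι ι ℂ) * (vand ι n θ)ᴴ)).trace -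
        (diagonal e * A⁻¹).trace‖ ≤
      Fintype.card ι * (δ⁻¹ * δ⁻¹) * (2⁻¹ * (η + η⁻¹ * ((n : ℝ)⁻¹ *
        ∑ p, ∑ b, ‖(vand ι n θ * A - M * vand ι n θ) p b‖ ^ 2))) := by
  set V := vand ι n θ with hV
  set D := V * A - M * V with hD
  have hMu := (isUnit_iff_isUnit_det _).1 (hM.isUnit hδ)
  have hAu := (isUnit_iff_isUnit_det _).1 (hA.isUnit hδ)
  have hnc : (n : ℂ) ≠ 0 := by exact_mod_cast hn.ne'
  have hnr : (0 : ℝ) < n := by exact_mod_cast hn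
  have e1 : (weight e n * M⁻¹ * (V * (1 : Matrix ι ι ℂ) * Vᴴ)).trace =
      (diagonal e * Vᴴ * M⁻¹ * V).trace := by
    rw [Matrix.mul_one, ← Matrix.mul_assoc, trace_mul_comm, hV,
      ← vand_conjTranspose_mul_weight]
    simp only [Matrix.mul_assoc]
  have e2 : (diagonal e * A⁻¹).trace = (n : ℂ)⁻¹ * (diagonal e * Vᴴ * V * A⁻¹).trace := by
    rw [Matrix.mul_assoc _ Vᴴ, vand_conjTranspose_mul_self, mul_smul_comm, mul_one, smul_mul_assoc,
      trace_smul, smul_eq_mul, inv_mul_cancel_left₀ hnc]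
  have e3 : M⁻¹ * V - V * A⁻¹ = M⁻¹ * D * A⁻¹ := by
    rw [hD, Matrix.mul_sub, Matrix.sub_mul, nonsing_inv_mul_cancel_left _ _ hMu,
      ← Matrix.mul_assoc, mul_nonsing_inv_cancel_right _ _ hAu]
  have e4 : (diagonal e * Vᴴ * M⁻¹ * V).trace - (diagonal e * Vᴴ * V * A⁻¹).trace =
      (diagonal e * Vᴴ * (M⁻¹ * D * A⁻¹)).trace := by
    rw [← trace_sub, ← e3, Matrix.mul_sub]
    simp only [Matrix.mul_assoc]
  rw [e1, e2, ← mul_sub, e4, norm_mul, norm_inv, Complex.norm_natCast]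
  have hx : ‖diagonal e * Vᴴ * (M⁻¹ * D * A⁻¹)‖ ≤ (1 * ‖V‖) * (δ⁻¹ * ‖D‖ * δ⁻¹) := by
    refine (l2_opNorm_mul _ _).trans (mul_le_mul ?_ ?_ (norm_nonneg _) (by positivity))
    · refine (l2_opNorm_mul _ _).trans ?_
      rw [l2_opNorm_conjTranspose]
      gcongr
      exact norm_diagonal_le_one he
    · refine (l2_opNorm_mul _ _).trans ?_
      refine mul_le_mul ((l2_opNorm_mul _ _).trans ?_) (hA.norm_inv_le hδ) (norm_nonneg _)
        (by positivity)
      gcongr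
      exact hM.norm_inv_le hδ
  have hVD : (n : ℝ)⁻¹ * (‖V‖ * ‖D‖) ≤ 2⁻¹ * (η + η⁻¹ * ((n : ℝ)⁻¹ *
      ∑ p, ∑ b, ‖D p b‖ ^ 2)) := by
    have h1 : ‖V‖ * ‖D‖ ≤ 2⁻¹ * (η * ‖V‖ ^ 2 + η⁻¹ * ‖D‖ ^ 2) := by
      have := sq_nonneg (η * ‖V‖ - ‖D‖)
      have h3 : η * (‖V‖ * ‖D‖) ≤ η * (2⁻¹ * (η * ‖V‖ ^ 2 + η⁻¹ * ‖D‖ ^ 2)) := by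
        have : η * (2⁻¹ * (η * ‖V‖ ^ 2 + η⁻¹ * ‖D‖ ^ 2)) =
            2⁻¹ * ((η * ‖V‖) ^ 2 + ‖D‖ ^ 2) := by field_simp
        rw [this]
        nlinarith
      exact le_of_mul_le_mul_left h3 hη
    calc _ ≤ (n : ℝ)⁻¹ * (2⁻¹ * (η * n + η⁻¹ * ∑ p, ∑ b, ‖D p b‖ ^ 2)) := by
          refine mul_le_mul_of_nonneg_left (h1.trans ?_) (by positivity)
          gcongr
          · exact norm_vand_sq_le n θ
          · exact l2_opNorm_sq_le_sum D
      _ = _ := by field_simp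
  calc _ ≤ (n : ℝ)⁻¹ * (Fintype.card ι * ((1 * ‖V‖) * (δ⁻¹ * ‖D‖ * δ⁻¹))) := by
        refine mul_le_mul_of_nonneg_left ((norm_trace_le _).trans ?_) (by positivity)
        gcongr
    _ = Fintype.card ι * (δ⁻¹ * δ⁻¹) * ((n : ℝ)⁻¹ * (‖V‖ * ‖D‖)) := by ring
    _ ≤ _ := by gcongr

lemma norm_vand_mul_sub_apply (n : ℕ) (h : ℝ → Matrix ι ι ℂ) (θ : ℝ) (i : Fin n) (a b : ι) :
    ‖(vand ι n θ * h θ - toep n h * vand ι n θ) (i, a) b‖ =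
      ‖h θ a b - ∑ m ∈ Finset.univ.image fun k : Fin n => (i : ℤ) - (k : ℤ),
        coeff (fun θ => h θ a b) m * chr (-m) θ‖ := by
  have hinj : Function.Injective fun k : Fin n => (i : ℤ) - (k : ℤ) := fun k l hkl => by
    simp only [sub_right_inj, Nat.cast_inj, Fin.val_inj] at hkl
    exact hkl
  rw [Finset.sum_image hinj.injOn, Matrix.sub_apply, vand_mul_apply, mul_apply,
    Fintype.sum_prod_type]
  have : ∀ k : Fin n, ∑ c, toep n h (i, a) (k, c) * vand ι n θ (k, c) b =
      chr i θ * (coeff (fun θ => h θ a b) ((i : ℤ) - k) * chr (-((i : ℤ) - k)) θ) := fun k => by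
    simp only [vand, mul_ite, mul_zero, Finset.sum_ite_eq', Finset.mem_univ, if_true]
    rw [mul_left_comm, ← chr_add, show (i : ℤ) + -((i : ℤ) - k) = k by ring]
    rfl
  simp only [this]
  rw [← Finset.mul_sum, ← mul_sub, norm_mul, norm_chr, one_mul]

lemma integrable_trace_mul_inv {δ : ℝ} (hδ : 0 < δ) {e : ι → ℂ} (he : ∀ a, ‖e a‖ ≤ 1)
    {h : ℝ → Matrix ι ι ℂ} (hm : AEMeasEntries h circ) (hc : ∀ᵐ θ ∂circ, Coercive δ (h θ)) :
    Integrable (fun θ => (diagonal e * (h θ)⁻¹).trace) circ := by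
  refine Integrable.of_bound ((aeMeasEntries_const _).mul hm.inv).trace
    (Fintype.card ι * (1 * δ⁻¹)) ?_
  filter_upwards [hc] with θ hθ
  refine (norm_trace_le _).trans ?_
  gcongr
  refine (l2_opNorm_mul _ _).trans ?_
  exact mul_le_mul (norm_diagonal_le_one he) (hθ.norm_inv_le hδ) (norm_nonneg _) zero_le_one

/-- Szegő-type limit for the inverse of a bounded coercive symbol. -/
lemma tendsto_trace_inv_of_bounded {δ R : ℝ} (hδ : 0 < δ) {e : ι → ℂ} (he : ∀ a, ‖e a‖ ≤ 1)
    {h : ℝ → Matrix ι ι ℂ} (hm : AEMeasEntries h circ)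
    (hR : ∀ a b, ∀ᵐ θ ∂circ, ‖h θ a b‖ ≤ R) (hc : ∀ᵐ θ ∂circ, Coercive δ (h θ)) :
    Tendsto (fun n : ℕ => (n : ℂ)⁻¹ * (weight e n * (toep n h)⁻¹).trace) atTop
      (𝓝 (∫ θ, (diagonal e * (h θ)⁻¹).trace ∂circ)) := by
  have h2 : ∀ a b, MemLp (fun θ => h θ a b) 2 circ := fun a b => MemLp.of_bound (hm a b) R (hR a b)
  have hi : ∀ a b, Integrable (fun θ => h θ a b) circ := fun a b => (h2 a b).integrable one_le_two
  set C : ℝ := Fintype.card ι * (δ⁻¹ * δ⁻¹)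
  have hC : 0 ≤ C := by positivity
  have hii := integrable_trace_mul_inv hδ he hm hc
  have hbound : ∀ η > 0, ∀ n : ℕ, 0 < n →
      ‖(n : ℂ)⁻¹ * (weight e n * (toep n h)⁻¹).trace - ∫ θ, (diagonal e * (h θ)⁻¹).trace ∂circ‖ ≤
      C * (2⁻¹ * (η + η⁻¹ * (∑ a, ∑ b, (n : ℝ)⁻¹ * ∑ i : Fin n, defect (fun θ => h θ a b)
        (Finset.univ.image fun k : Fin n => (i : ℤ) - (k : ℤ))))) := by
    intro η hη n hn
    have hM := coercive_toep n hi hc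
    have hdi : ∀ (p : Fin n × ι) b, Integrable
        (fun θ => ‖(vand ι n θ * h θ - toep n h * vand ι n θ) p b‖ ^ 2) circ := fun p b => by
      obtain ⟨i, a⟩ := p
      simp only [norm_vand_mul_sub_apply]
      exact ((h2 a b).sub (memLp_trig _ _)).integrable_norm_pow two_ne_zero
    have hsum : Integrable (fun θ => ∑ p, ∑ b,
        ‖(vand ι n θ * h θ - toep n h * vand ι n θ) p b‖ ^ 2) circ :=
      integrable_finsetSum _ fun p _ => integrable_finsetSum _ fun b _ => hdi p b
    have h1 := trace_mul_toep n (integrable_const_one (ι := ι)) (weight e n * (toep n h)⁻¹)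
    rw [toep_one, mul_one] at h1
    rw [h1, ← integral_const_mul, ← integral_sub
      ((integrable_trace_mul_vand n integrable_const_one _).const_mul _) hii]
    refine (norm_integral_le_of_norm_le
      (g := fun θ => C * (2⁻¹ * (η + η⁻¹ * ((n : ℝ)⁻¹ *
        ∑ p, ∑ b, ‖(vand ι n θ * h θ - toep n h * vand ι n θ) p b‖ ^ 2)))) ?_ ?_).trans_eq ?_
    · exact (((integrable_const _).add ((hsum.const_mul _).const_mul _)).const_mul _).const_mul _
    · filter_upwards [hc] with θ hθ using norm_trace_vand_sub_le hδ hη hn he hM hθ θ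
    · rw [integral_const_mul, integral_const_mul,
        integral_add (integrable_const _) ((hsum.const_mul _).const_mul _), integral_const_mul,
        integral_const_mul,
        integral_finsetSum _ fun p _ => integrable_finsetSum _ fun b _ => hdi p b]
      simp only [integral_finsetSum _ fun b _ => hdi _ b, norm_vand_mul_sub_apply,
        Fintype.sum_prod_type]
      rw [integral_const, probReal_univ, one_smul, Finset.sum_comm]
      simp only [← Finset.mul_sum]
      congr 6 with a
      rw [Finset.sum_comm]
      rfl
  rw [Metric.tendsto_nhds]
  intro ε hε
  have hη : 0 < ε / (C + 1) := by positivity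
  have hl : Tendsto (fun n : ℕ => C * (2⁻¹ * (ε / (C + 1) + (ε / (C + 1))⁻¹ *
      (∑ a, ∑ b, (n : ℝ)⁻¹ * ∑ i : Fin n, defect (fun θ => h θ a b)
        (Finset.univ.image fun k : Fin n => (i : ℤ) - (k : ℤ)))))) atTop
      (𝓝 (C * (2⁻¹ * (ε / (C + 1) + (ε / (C + 1))⁻¹ * ∑ _a : ι, ∑ _b : ι, 0)))) :=
    (((tendsto_finsetSum _ fun a _ => tendsto_finsetSum _ fun b _ =>
      tendsto_mean_defect (h2 a b)).const_mul _).const_add _).const_mul _ |>.const_mul _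
  have hlt : C * (2⁻¹ * (ε / (C + 1) + (ε / (C + 1))⁻¹ * ∑ _a : ι, ∑ _b : ι, 0)) < ε := by
    simp only [Finset.sum_const_zero, mul_zero, add_zero]
    have h1 : C * (ε / (C + 1)) ≤ ε := by
      rw [mul_div_assoc', div_le_iff₀ (by positivity)]
      nlinarith
    linarith
  filter_upwards [hl.eventually (gt_mem_nhds hlt), eventually_gt_atTop 0] with n h1 hn
  rw [dist_eq_norm]
  exact (hbound _ hη n hn).trans_lt h1

end Bounded

section Integrable

open scoped Topology Matrix.Norms.L2Operator

lemma tendsto_of_approx {E : Type*} [PseudoMetricSpace E] {a : ℕ → E} {l : E}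
    (h : ∀ η > 0, ∃ (b : ℕ → E) (m : E), Tendsto b atTop (𝓝 m) ∧
      (∀ᶠ n in atTop, dist (a n) (b n) ≤ η) ∧ dist m l ≤ η) : Tendsto a atTop (𝓝 l) := by
  rw [Metric.tendsto_nhds]
  intro ε hε
  obtain ⟨b, m, hb, hab, hm⟩ := h (ε / 4) (by positivity)
  filter_upwards [Metric.tendsto_nhds.1 hb (ε / 4) (by positivity), hab] with n h1 h2
  calc dist (a n) l ≤ dist (a n) (b n) + dist (b n) m + dist m l := dist_triangle4 _ _ _ _
    _ < ε := by linarith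

variable {ι : Type*} [Fintype ι] [DecidableEq ι]

lemma norm_trace_inv_sub_le {δ : ℝ} (hδ : 0 < δ) {E A B : Matrix ι ι ℂ} (hE : ‖E‖ ≤ 1)
    (hA : Coercive δ A) (hB : Coercive δ B) :
    ‖(E * A⁻¹).trace - (E * B⁻¹).trace‖ ≤ δ⁻¹ * δ⁻¹ * ∑ a, ∑ b, ‖(B - A) a b‖ := by
  rw [← trace_sub, ← mul_sub, inv_sub_inv_eq (hA.isUnit hδ) (hB.isUnit hδ), ← mul_assoc,
    trace_mul_comm, ← mul_assoc, ← mul_assoc]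
  refine (norm_trace_mul_le _ _).trans ?_
  gcongr
  refine (l2_opNorm_mul _ _).trans (mul_le_mul ?_ (hA.norm_inv_le hδ) (norm_nonneg _)
    (inv_nonneg.2 hδ.le))
  refine (l2_opNorm_mul _ _).trans ?_
  simpa using mul_le_mul (hB.norm_inv_le hδ) hE (norm_nonneg _) (inv_nonneg.2 hδ.le)

lemma norm_trace_toep_inv_sub_le {δ : ℝ} (hδ : 0 < δ) {e : ι → ℂ} (he : ∀ a, ‖e a‖ ≤ 1)
    {h k : ℝ → Matrix ι ι ℂ} (hh : ∀ a b, Integrable (fun θ => h θ a b) circ)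
    (hk : ∀ a b, Integrable (fun θ => k θ a b) circ) (hhc : ∀ᵐ θ ∂circ, Coercive δ (h θ))
    (hkc : ∀ᵐ θ ∂circ, Coercive δ (k θ)) (n : ℕ) :
    ‖(n : ℂ)⁻¹ * (weight e n * (toep n h)⁻¹).trace -
        (n : ℂ)⁻¹ * (weight e n * (toep n k)⁻¹).trace‖ ≤
      δ⁻¹ * δ⁻¹ * ∫ θ, ∑ a, ∑ b, ‖(k θ - h θ) a b‖ ∂circ := by
  have hI0 : 0 ≤ ∫ θ, ∑ a, ∑ b, ‖(k θ - h θ) a b‖ ∂circ := integral_nonneg fun _ => by positivity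
  have hA := coercive_toep n hh hhc
  have hB := coercive_toep n hk hkc
  rcases n.eq_zero_or_pos with rfl | hn
  · simp only [Nat.cast_zero, _root_.inv_zero, zero_mul, sub_zero, norm_zero]
    positivity
  have hd : ∀ a b, Integrable (fun θ => (k θ - h θ) a b) circ := fun a b => (hk a b).sub (hh a b)
  have hds : Integrable (fun θ => ∑ a, ∑ b, ‖(k θ - h θ) a b‖) circ :=
    integrable_finsetSum _ fun a _ => integrable_finsetSum _ fun b _ => (hd a b).norm
  rw [← mul_sub, norm_mul, norm_inv, Complex.norm_natCast, ← trace_sub, ← mul_sub,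
    inv_sub_inv_eq (hA.isUnit hδ) (hB.isUnit hδ), ← mul_assoc,
    trace_mul_comm, ← mul_assoc, ← mul_assoc, ← toep_sub n hk hh, trace_mul_toep n hd]
  set X := (toep n k)⁻¹ * weight e n * (toep n h)⁻¹
  have hX : ‖X‖ ≤ δ⁻¹ * δ⁻¹ := by
    refine (l2_opNorm_mul _ _).trans (mul_le_mul ?_ (hA.norm_inv_le hδ) (norm_nonneg _)
      (inv_nonneg.2 hδ.le))
    refine (l2_opNorm_mul _ _).trans ?_
    simpa using mul_le_mul (hB.norm_inv_le hδ) (norm_weight_le he n) (norm_nonneg _)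
      (inv_nonneg.2 hδ.le)
  have hpt : ∀ θ, ‖(X * (vand ι n θ * (k θ - h θ) * (vand ι n θ)ᴴ)).trace‖ ≤
      n * (δ⁻¹ * δ⁻¹) * ∑ a, ∑ b, ‖(k θ - h θ) a b‖ := fun θ => by
    rw [← Matrix.mul_assoc, ← Matrix.mul_assoc, trace_mul_comm, ← Matrix.mul_assoc,
      ← Matrix.mul_assoc]
    refine (norm_trace_mul_le _ _).trans ?_
    refine mul_le_mul_of_nonneg_right ?_ (by positivity)
    calc ‖(vand ι n θ)ᴴ * X * vand ι n θ‖ ≤ ‖(vand ι n θ)ᴴ‖ * ‖X‖ * ‖vand ι n θ‖ :=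
          (l2_opNorm_mul _ _).trans
            (mul_le_mul_of_nonneg_right (l2_opNorm_mul _ _) (norm_nonneg _))
      _ = ‖vand ι n θ‖ ^ 2 * ‖X‖ := by rw [l2_opNorm_conjTranspose]; ring
      _ ≤ _ := mul_le_mul (norm_vand_sq_le n θ) hX (norm_nonneg _) (Nat.cast_nonneg n)
  have hnr : (0 : ℝ) < n := by exact_mod_cast hn
  rw [inv_mul_le_iff₀ hnr, ← mul_assoc, ← integral_const_mul]
  exact norm_integral_le_of_norm_le (hds.const_mul _) (Eventually.of_forall hpt)

omit [DecidableEq ι] in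
lemma Coercive.convex_comb {δ c : ℝ} (hc0 : 0 ≤ c) (hc1 : c ≤ 1) {A B : Matrix ι ι ℂ}
    (hA : Coercive δ A) (hB : Coercive δ B) :
    Coercive δ ((c : ℂ) • A + ((1 - c : ℝ) : ℂ) • B) := fun x => by
  rw [add_mulVec, smul_mulVec, smul_mulVec, dotProduct_add, dotProduct_smul, dotProduct_smul,
    smul_eq_mul, smul_eq_mul, Complex.add_re, Complex.re_ofReal_mul, Complex.re_ofReal_mul]
  have h1 := mul_le_mul_of_nonneg_left (hA x) hc0
  have h2 := mul_le_mul_of_nonneg_left (hB x) (sub_nonneg.2 hc1)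
  linarith

lemma coercive_smul_one (δ : ℝ) : Coercive δ ((δ : ℂ) • (1 : Matrix ι ι ℂ)) := fun x => by
  rw [smul_mulVec, one_mulVec, dotProduct_smul, smul_eq_mul, Complex.re_ofReal_mul,
    star_dotProduct_self_re]

/-- Smooth cut-off of a matrix, retaining coercivity. -/
noncomputable def cutoff (δ R : ℝ) (A : Matrix ι ι ℂ) : Matrix ι ι ℂ :=
  ((R / (R + ∑ a, ∑ b, ‖A a b‖) : ℝ) : ℂ) • A +
    ((1 - R / (R + ∑ a, ∑ b, ‖A a b‖) : ℝ) : ℂ) • ((δ : ℂ) • 1)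

omit [DecidableEq ι] in
lemma cutoff_coeff_mem {R : ℝ} (hR : 0 < R) (A : Matrix ι ι ℂ) :
    0 ≤ R / (R + ∑ a, ∑ b, ‖A a b‖) ∧ R / (R + ∑ a, ∑ b, ‖A a b‖) ≤ 1 := by
  have : 0 ≤ ∑ a, ∑ b, ‖A a b‖ := by positivity
  exact ⟨by positivity, (div_le_one (by positivity)).2 (by linarith)⟩

lemma Coercive.cutoff {δ R : ℝ} (hR : 0 < R) {A : Matrix ι ι ℂ} (hA : Coercive δ A) :
    Coercive δ (cutoff δ R A) :=
  hA.convex_comb (cutoff_coeff_mem hR A).1 (cutoff_coeff_mem hR A).2 (coercive_smul_one δ)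

lemma norm_cutoff_le {δ R : ℝ} (hδ : 0 ≤ δ) (hR : 0 < R) (A : Matrix ι ι ℂ) (a b : ι) :
    ‖BlockToeplitz.cutoff δ R A a b‖ ≤ R + δ := by
  have h0 : 0 ≤ ∑ a, ∑ b, ‖A a b‖ := by positivity
  obtain ⟨h1, h2⟩ := cutoff_coeff_mem hR A
  have hab : ‖A a b‖ ≤ ∑ a, ∑ b, ‖A a b‖ :=
    (Finset.single_le_sum (f := fun b => ‖A a b‖) (fun _ _ => norm_nonneg _)
      (Finset.mem_univ b)).trans
      (Finset.single_le_sum (f := fun a => ∑ b, ‖A a b‖)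
        (fun _ _ => Finset.sum_nonneg fun _ _ => norm_nonneg _) (Finset.mem_univ a))
  have h3 : R / (R + ∑ a, ∑ b, ‖A a b‖) * ‖A a b‖ ≤ R := by
    rw [div_mul_eq_mul_div, div_le_iff₀ (by positivity)]
    nlinarith
  have h4 : ‖(1 : Matrix ι ι ℂ) a b‖ ≤ 1 := by
    rw [one_apply]; split_ifs <;> simp
  rw [BlockToeplitz.cutoff, Matrix.add_apply, Matrix.smul_apply, Matrix.smul_apply,
    Matrix.smul_apply, smul_eq_mul, smul_eq_mul, smul_eq_mul]
  refine (norm_add_le _ _).trans ?_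
  rw [norm_mul, norm_mul, norm_mul, Complex.norm_real, Complex.norm_real, Complex.norm_real,
    Real.norm_of_nonneg h1, Real.norm_of_nonneg (sub_nonneg.2 h2), Real.norm_of_nonneg hδ]
  have h5 : (1 - R / (R + ∑ a, ∑ b, ‖A a b‖)) * (δ * ‖(1 : Matrix ι ι ℂ) a b‖) ≤ 1 * (δ * 1) := by
    gcongr
    linarith
  linarith

lemma cutoff_sub (δ R : ℝ) (A : Matrix ι ι ℂ) :
    cutoff δ R A - A = ((1 - R / (R + ∑ a, ∑ b, ‖A a b‖) : ℝ) : ℂ) • ((δ : ℂ) • 1 - A) := by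
  rw [cutoff, smul_sub, Complex.ofReal_sub, sub_smul, sub_smul, Complex.ofReal_one, one_smul,
    one_smul]
  abel

lemma AEMeasEntries.cutoff {α : Type*} [MeasurableSpace α] {μ : Measure α}
    {h : α → Matrix ι ι ℂ} (hh : AEMeasEntries h μ) (δ R : ℝ) :
    AEMeasEntries (fun θ => BlockToeplitz.cutoff δ R (h θ)) μ := fun a b => by
  have hs : AEStronglyMeasurable (fun θ => R / (R + ∑ a, ∑ b, ‖h θ a b‖)) μ :=
    (((Finset.aestronglyMeasurable_fun_sum _ fun a _ =>
      Finset.aestronglyMeasurable_fun_sum _ fun b _ => (hh a b).norm).aemeasurable.const_add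
        R).const_div R).aestronglyMeasurable
  exact ((Complex.continuous_ofReal.comp_aestronglyMeasurable hs).mul (hh a b)).add
    ((Complex.continuous_ofReal.comp_aestronglyMeasurable
      (aestronglyMeasurable_const.sub hs)).mul aestronglyMeasurable_const)

lemma tendsto_integral_cutoff_sub {δ : ℝ} {h : ℝ → Matrix ι ι ℂ}
    (hh : ∀ a b, Integrable (fun θ => h θ a b) circ) :
    Tendsto (fun k : ℕ => ∫ θ, ∑ a, ∑ b, ‖(cutoff δ (k + 1) (h θ) - h θ) a b‖ ∂circ)
      atTop (𝓝 0) := by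
  have hm : AEMeasEntries h circ := fun a b => (hh a b).1
  have e0 : (0 : ℝ) = ∫ _ : ℝ, 0 ∂circ := by simp
  have hpos : ∀ k : ℕ, (0 : ℝ) < k + 1 := fun k => by positivity
  rw [e0]
  refine tendsto_integral_of_dominated_convergence
    (fun θ => ∑ a, ∑ b, ‖((δ : ℂ) • (1 : Matrix ι ι ℂ) - h θ) a b‖) (fun k => ?_) ?_
    (fun k => Eventually.of_forall fun θ => ?_) (Eventually.of_forall fun θ => ?_)
  · exact Finset.aestronglyMeasurable_fun_sum _ fun a _ =>
      Finset.aestronglyMeasurable_fun_sum _ fun b _ => ((hm.cutoff δ _ a b).sub (hm a b)).norm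
  · exact integrable_finsetSum _ fun a _ => integrable_finsetSum _ fun b _ =>
      ((integrable_const _).sub (hh a b)).norm
  · rw [Real.norm_of_nonneg (by positivity)]
    obtain ⟨h1, h2⟩ := cutoff_coeff_mem (hpos k) (h θ)
    refine Finset.sum_le_sum fun a _ => Finset.sum_le_sum fun b _ => ?_
    rw [cutoff_sub, Matrix.smul_apply, norm_smul, Complex.norm_real,
      Real.norm_of_nonneg (sub_nonneg.2 h2)]
    exact mul_le_of_le_one_left (norm_nonneg _) (by linarith)
  · set N := ∑ a, ∑ b, ‖h θ a b‖
    have hN : 0 ≤ N := by positivity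
    have hlim : Tendsto (fun k : ℕ => 1 - ((k : ℝ) + 1) / (k + 1 + N)) atTop (𝓝 0) := by
      have h1 : Tendsto (fun k : ℕ => (k : ℝ) + 1 + N) atTop atTop :=
        tendsto_atTop_add_const_right _ _ (tendsto_atTop_add_const_right _ _
          tendsto_natCast_atTop_atTop)
      refine (h1.const_div_atTop N).congr fun k => ?_
      have := hpos k
      field_simp
      ring
    have : Tendsto (fun k : ℕ => ∑ a, ∑ b, ‖((1 - ((k : ℝ) + 1) / (k + 1 + N) : ℝ) : ℂ) *
        ((δ : ℂ) • (1 : Matrix ι ι ℂ) - h θ) a b‖) atTop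
        (𝓝 (∑ a, ∑ b, ‖((0 : ℝ) : ℂ) * ((δ : ℂ) • (1 : Matrix ι ι ℂ) - h θ) a b‖)) :=
      tendsto_finsetSum _ fun a _ => tendsto_finsetSum _ fun b _ =>
        ((Complex.continuous_ofReal.continuousAt.tendsto.comp hlim).mul_const _).norm
    simp only [cutoff_sub, Matrix.smul_apply (_ : ℂ), smul_eq_mul]
    simp only [Complex.ofReal_zero, zero_mul, norm_zero, Finset.sum_const_zero] at this
    exact this

/-- Szegő-type limit for the inverse of an integrable coercive symbol. -/
theorem tendsto_trace_inv {δ : ℝ} (hδ : 0 < δ) {e : ι → ℂ} (he : ∀ a, ‖e a‖ ≤ 1)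
    {h : ℝ → Matrix ι ι ℂ} (hh : ∀ a b, Integrable (fun θ => h θ a b) circ)
    (hc : ∀ᵐ θ ∂circ, Coercive δ (h θ)) :
    Tendsto (fun n : ℕ => (n : ℂ)⁻¹ * (weight e n * (toep n h)⁻¹).trace) atTop
      (𝓝 (∫ θ, (diagonal e * (h θ)⁻¹).trace ∂circ)) := by
  have hm : AEMeasEntries h circ := fun a b => (hh a b).1
  refine tendsto_of_approx fun η hη => ?_
  have hlim := (tendsto_integral_cutoff_sub (δ := δ) hh).const_mul (δ⁻¹ * δ⁻¹)
  rw [mul_zero] at hlim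
  obtain ⟨k, hk⟩ := (hlim.eventually (gt_mem_nhds hη)).exists
  have hpos : (0 : ℝ) < k + 1 := by positivity
  have hkc : ∀ᵐ θ ∂circ, Coercive δ (cutoff δ (k + 1) (h θ)) := by
    filter_upwards [hc] with θ hθ using hθ.cutoff hpos
  have hki : ∀ a b, Integrable (fun θ => cutoff δ (k + 1) (h θ) a b) circ := fun a b =>
    Integrable.of_bound (hm.cutoff δ _ a b) _
      (Eventually.of_forall fun θ => norm_cutoff_le hδ.le hpos _ _ _)
  refine ⟨_, _, tendsto_trace_inv_of_bounded hδ he (hm.cutoff δ (k + 1))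
    (fun a b => Eventually.of_forall fun θ => norm_cutoff_le hδ.le hpos _ _ _) hkc,
    Eventually.of_forall fun n => ?_, ?_⟩
  · rw [dist_eq_norm]
    exact (norm_trace_toep_inv_sub_le hδ he hh hki hc hkc n).trans hk.le
  · have hds : Integrable (fun θ => ∑ a, ∑ b, ‖(cutoff δ (k + 1) (h θ) - h θ) a b‖) circ :=
      integrable_finsetSum _ fun a _ => integrable_finsetSum _ fun b _ =>
        ((hki a b).sub (hh a b)).norm
    rw [dist_comm, dist_eq_norm, ← integral_sub (integrable_trace_mul_inv hδ he hm hc)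
      (integrable_trace_mul_inv hδ he (hm.cutoff δ _) hkc)]
    refine le_trans ?_ hk.le
    rw [← integral_const_mul]
    refine norm_integral_le_of_norm_le (hds.const_mul _) ?_
    filter_upwards [hc, hkc] with θ h1 h2
      using norm_trace_inv_sub_le hδ (norm_diagonal_le_one he) h1 h2

end Integrable

section Schur

open scoped Topology Matrix.Norms.L2Operator

variable {κ ι : Type*} [Fintype κ] [DecidableEq κ] [Fintype ι] [DecidableEq ι]

lemma trace_diagonal_elim_mul (A : Matrix (κ ⊕ ι) (κ ⊕ ι) ℂ) :
    (diagonal (Sum.elim (fun _ => 1) fun _ => 0) * A).trace = A.toBlocks₁₁.trace := by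
  simp [trace, diagonal_mul, Fintype.sum_sum_type, toBlocks₁₁]

lemma trace_diagonal_elim_mul_inv {δ t ε : ℝ} (hδ : 0 < δ) (ht : δ ≤ t) (hε : δ ≤ ε)
    (B : Matrix κ ι ℂ) {G : Matrix ι ι ℂ} (hG : G.PosSemidef) :
    (diagonal (Sum.elim (fun _ => 1) fun _ => 0) *
      (fromBlocks ((t : ℂ) • 1) B (-Bᴴ) (G + (ε : ℂ) • 1))⁻¹).trace =
      (schurResolvent t B (G + (ε : ℂ) • 1)).trace := by
  rw [trace_diagonal_elim_mul, toBlocks₁₁_inv ((coercive_fromBlocks ht hε B hG).isUnit hδ)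
    (PosDef.posSemidef_add hG (posDef_real_smul_one (hδ.trans_le hε))).isUnit, Matrix.mul_neg,
    sub_neg_eq_add, schurResolvent]

/-- The block matrix whose inverse has `schurResolvent` as its upper left block. -/
noncomputable def schurBlock (t ε : ℝ) (B : Matrix κ ι ℂ) (G : Matrix ι ι ℂ) :
    Matrix (κ ⊕ ι) (κ ⊕ ι) ℂ :=
  fromBlocks ((t : ℂ) • 1) B (-Bᴴ) (G + (ε : ℂ) • 1)

variable {f : ℝ → Matrix κ ι ℂ} {g : ℝ → Matrix ι ι ℂ}

omit [Fintype κ] [Fintype ι] in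
lemma integrable_schurBlock (hf : ∀ a b, Integrable (fun θ => f θ a b) circ)
    (hg : ∀ a b, Integrable (fun θ => g θ a b) circ) (t ε : ℝ) (a b : κ ⊕ ι) :
    Integrable (fun θ => schurBlock t ε (f θ) (g θ) a b) circ := by
  rcases a with a | a <;> rcases b with b | b
  · exact integrable_const _
  · exact hf a b
  · exact ((LinearIsometryEquiv.integrable_comp_iff Complex.conjLIE).2 (hf b a)).neg
  · exact (hg a b).add (integrable_const _)

omit [Fintype ι] in
lemma toep_add_smul_one (hg : ∀ a b, Integrable (fun θ => g θ a b) circ) (n : ℕ) (ε : ℂ) :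
    toep n (fun θ => g θ + ε • 1) = toep n g + ε • 1 := by
  rw [toep_add n (k := fun _ => ε • (1 : Matrix ι ι ℂ)) hg fun _ _ => integrable_const _,
    toep_smul_one]

omit [DecidableEq κ] [DecidableEq ι] in
lemma trace_submatrix_equiv (A : Matrix κ κ ℂ) (σ : ι ≃ κ) : (A.submatrix σ σ).trace = A.trace :=
  σ.sum_comp fun i => A i i

lemma trace_weight_mul_toep_schurBlock {t ε : ℝ} (ht : 0 < t) (hε : 0 < ε)
    (hg : ∀ a b, Integrable (fun θ => g θ a b) circ) (hpd : ∀ᵐ θ ∂circ, (g θ).PosDef) (n : ℕ) :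
    (weight (Sum.elim (fun _ => 1) fun _ => 0) n *
      (toep n fun θ => schurBlock t ε (f θ) (g θ))⁻¹).trace =
      (schurResolvent t (toep n f) (toep n g + (ε : ℂ) • 1)).trace := by
  set σ := (Equiv.prodSumDistrib (Fin n) κ ι).symm
  have h1 : (toep n fun θ => schurBlock t ε (f θ) (g θ)).submatrix σ σ =
      fromBlocks ((t : ℂ) • 1) (toep n f) (-(toep n f)ᴴ) (toep n g + (ε : ℂ) • 1) := by
    refine (toep_fromBlocks n _ _ _ _).trans ?_
    rw [toep_smul_one, toep_neg, toep_conjTranspose, toep_add_smul_one hg]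
  have h2 : (weight (Sum.elim (fun _ : κ => (1 : ℂ)) fun _ : ι => 0) n).submatrix σ σ =
      diagonal (Sum.elim (fun _ => 1) fun _ => 0) := by
    rw [weight, submatrix_diagonal_equiv]
    congr 1
    ext p
    rcases p with p | p <;> rfl
  rw [← trace_submatrix_equiv _ σ, ← submatrix_mul_equiv _ _ _ σ _, ← inv_submatrix_equiv, h1, h2]
  exact trace_diagonal_elim_mul_inv (lt_min ht hε) (min_le_left t ε) (min_le_right t ε) _
    (posDef_toep n hg hpd).posSemidef

lemma tendsto_trace_schurResolvent_add (hf : ∀ a b, Integrable (fun θ => f θ a b) circ)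
    (hg : ∀ a b, Integrable (fun θ => g θ a b) circ) (hpd : ∀ᵐ θ ∂circ, (g θ).PosDef) {t ε : ℝ}
    (ht : 0 < t) (hε : 0 < ε) :
    Tendsto (fun n : ℕ => (n : ℝ)⁻¹ *
      (schurResolvent t (toep n f) (toep n g + (ε : ℂ) • 1)).trace.re) atTop
      (𝓝 (∫ θ, (schurResolvent t (f θ) (g θ + (ε : ℂ) • 1)).trace.re ∂circ)) := by
  have he : ∀ a : κ ⊕ ι, ‖Sum.elim (fun _ : κ => (1 : ℂ)) (fun _ : ι => 0) a‖ ≤ 1 := by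
    rintro (a | a) <;> simp
  have hc : ∀ᵐ θ ∂circ, Coercive (min t ε) (schurBlock t ε (f θ) (g θ)) := by
    filter_upwards [hpd] with θ hθ using
      coercive_fromBlocks (min_le_left t ε) (min_le_right t ε) (f θ) hθ.posSemidef
  have hS := integrable_schurBlock hf hg t ε
  have ha : (fun θ => (diagonal (Sum.elim (fun _ : κ => (1 : ℂ)) fun _ : ι => 0) *
      (schurBlock t ε (f θ) (g θ))⁻¹).trace) =ᵐ[circ]
      fun θ => (schurResolvent t (f θ) (g θ + (ε : ℂ) • 1)).trace := by
    filter_upwards [hpd] with θ hθ using trace_diagonal_elim_mul_inv (lt_min ht hε)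
      (min_le_left t ε) (min_le_right t ε) _ hθ.posSemidef
  have h := tendsto_trace_inv (lt_min ht hε) he hS hc
  have hi := (integrable_trace_mul_inv (lt_min ht hε) he (fun a b => (hS a b).1) hc).congr ha
  simp only [trace_weight_mul_toep_schurBlock ht hε hg hpd] at h
  rw [integral_congr_ae ha] at h
  have h2 := integral_re hi
  simp only [RCLike.re_to_complex] at h2
  rw [h2]
  refine ((Complex.continuous_re.tendsto _).comp h).congr fun n => ?_
  rw [Function.comp_apply, ← Complex.ofReal_natCast, ← Complex.ofReal_inv, Complex.re_ofReal_mul]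
lemma coercive_add_smul_one {G : Matrix ι ι ℂ} (hG : G.PosSemidef) (ε : ℝ) :
    Coercive ε (G + (ε : ℂ) • 1) := fun x => by
  rw [add_mulVec, dotProduct_add, Complex.add_re]
  have h1 := coercive_smul_one ε x
  have h2 : 0 ≤ (star x ⬝ᵥ (G *ᵥ x)).re := hG.re_dotProduct_nonneg x
  linarith

lemma trace_compression_le {n : ℕ} {k : Matrix ι ι ℂ} (hk : k.PosDef)
    {X : Matrix (Fin n × ι) (Fin n × ι) ℂ} (hX : X.IsHermitian) (θ : ℝ) :
    2 * (X * (vand ι n θ * (1 : Matrix ι ι ℂ) * (vand ι n θ)ᴴ)).trace.re -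
      (X * X * (vand ι n θ * k * (vand ι n θ)ᴴ)).trace.re ≤ n * k⁻¹.trace.re := by
  set V := vand ι n θ with hV
  have hku := (isUnit_iff_isUnit_det _).1 hk.isUnit
  have h := (hk.posSemidef.conjTranspose_mul_mul_same (k⁻¹ * Vᴴ - Vᴴ * X)).trace_nonneg
  have e : (k⁻¹ * Vᴴ - Vᴴ * X)ᴴ * k * (k⁻¹ * Vᴴ - Vᴴ * X) =
      V * k⁻¹ * Vᴴ - V * Vᴴ * X - X * (V * Vᴴ) + X * (V * k * Vᴴ) * X := by
    rw [conjTranspose_sub, conjTranspose_mul, conjTranspose_mul, conjTranspose_conjTranspose,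
      hk.inv.isHermitian.eq, hX.eq, Matrix.sub_mul, nonsing_inv_mul_cancel_right _ _ hku,
      Matrix.sub_mul, Matrix.mul_sub, Matrix.mul_sub]
    have : X * V * k * (k⁻¹ * Vᴴ) = X * (V * Vᴴ) := by
      rw [← Matrix.mul_assoc, mul_nonsing_inv_cancel_right _ _ hku, Matrix.mul_assoc]
    rw [this]
    simp only [Matrix.mul_assoc]
    abel
  rw [e, trace_add, trace_sub, trace_sub, trace_mul_comm (V * k⁻¹), ← Matrix.mul_assoc, hV,
    vand_conjTranspose_mul_self, ← hV, smul_mul_assoc, one_mul, trace_smul, smul_eq_mul,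
    trace_mul_comm (V * Vᴴ) X, trace_mul_comm (X * (V * k * Vᴴ)) X, ← Matrix.mul_assoc X X] at h
  have h' := (Complex.le_def.1 h).1
  rw [Complex.zero_re, Complex.add_re, Complex.sub_re, Complex.sub_re, ← Complex.ofReal_natCast,
    Complex.re_ofReal_mul] at h'
  rw [Matrix.mul_one]
  linarith

/-- Compression inequality `tr (T_n(k)⁻¹) ≤ n ∫ tr k⁻¹`. -/
lemma trace_inv_toep_le {k : ℝ → Matrix ι ι ℂ} (hk : ∀ a b, Integrable (fun θ => k θ a b) circ)
    (hpd : ∀ᵐ θ ∂circ, (k θ).PosDef) (hi : Integrable (fun θ => (k θ)⁻¹.trace.re) circ) (n : ℕ) :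
    (toep n k)⁻¹.trace.re ≤ n * ∫ θ, (k θ)⁻¹.trace.re ∂circ := by
  have hT := posDef_toep n hk hpd
  set X := (toep n k)⁻¹ with hXdef
  have hX : X.IsHermitian := hT.inv.isHermitian
  have h1 := integral_re (integrable_trace_mul_vand n (integrable_const_one (ι := ι)) X)
  have h2 := integral_re (integrable_trace_mul_vand n hk (X * X))
  have i1 := (integrable_trace_mul_vand n (integrable_const_one (ι := ι)) X).re
  have i2 := (integrable_trace_mul_vand n hk (X * X)).re
  rw [← trace_mul_toep n integrable_const_one, toep_one, mul_one] at h1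
  rw [← trace_mul_toep n hk, mul_assoc, hXdef,
    nonsing_inv_mul _ ((isUnit_iff_isUnit_det _).1 hT.isUnit), mul_one, ← hXdef] at h2
  simp only [RCLike.re_to_complex] at h1 h2 i1 i2
  have h3 : ∫ θ, (2 * (X * (vand ι n θ * (1 : Matrix ι ι ℂ) * (vand ι n θ)ᴴ)).trace.re -
      (X * X * (vand ι n θ * k θ * (vand ι n θ)ᴴ)).trace.re) ∂circ ≤
      ∫ θ, n * (k θ)⁻¹.trace.re ∂circ := by
    refine integral_mono_ae ((i1.const_mul 2).sub i2) (hi.const_mul _) ?_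
    filter_upwards [hpd] with θ hθ using trace_compression_le hθ hX θ
  rw [integral_sub (i1.const_mul 2) i2, integral_const_mul, integral_const_mul, h1, h2] at h3
  linarith

lemma trace_re_inv_add_smul_one_bounds {ε : ℝ} (hε : 0 < ε) {G : Matrix ι ι ℂ} (hG : G.PosDef) :
    0 ≤ (G + (ε : ℂ) • 1)⁻¹.trace.re ∧ (G + (ε : ℂ) • 1)⁻¹.trace.re ≤ G⁻¹.trace.re ∧
      ε * (G + (ε : ℂ) • 1)⁻¹.trace.re ≤ Fintype.card ι := by
  have hGε : (G + (ε : ℂ) • 1).PosDef := hG.add (posDef_real_smul_one hε)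
  refine ⟨(Complex.le_def.1 hGε.inv.posSemidef.trace_nonneg).1, ?_, ?_⟩
  · have h := (posSemidef_inv_sub_inv hG hGε (by
      rw [add_sub_cancel_left]; exact (posDef_real_smul_one hε).posSemidef)).trace_nonneg
    rw [trace_sub, sub_nonneg] at h
    exact (Complex.le_def.1 h).1
  · have h := (Complex.re_le_norm _).trans (norm_trace_le (G + (ε : ℂ) • 1)⁻¹)
    have h2 := (coercive_add_smul_one hG.posSemidef ε).norm_inv_le hε
    calc ε * (G + (ε : ℂ) • 1)⁻¹.trace.re ≤ ε * (Fintype.card ι * ε⁻¹) := by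
          gcongr
          exact h.trans (by gcongr)
      _ = Fintype.card ι := by field_simp

lemma integrable_trace_inv_add_smul_one (hg : AEMeasEntries g circ)
    (hpd : ∀ᵐ θ ∂circ, (g θ).PosDef) {ε : ℝ} (hε : 0 < ε) :
    Integrable (fun θ => ε * (g θ + (ε : ℂ) • 1)⁻¹.trace.re) circ := by
  refine Integrable.of_bound ((Complex.continuous_re.comp_aestronglyMeasurable
    (hg.add (aeMeasEntries_const _)).inv.trace).const_mul ε) (Fintype.card ι) ?_
  filter_upwards [hpd] with θ hθ
  obtain ⟨h0, -, h1⟩ := trace_re_inv_add_smul_one_bounds hε hθ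
  rwa [Real.norm_of_nonneg (by positivity)]

lemma tendsto_integral_trace_inv_add_smul_one (hg : AEMeasEntries g circ)
    (hpd : ∀ᵐ θ ∂circ, (g θ).PosDef) :
    Tendsto (fun k : ℕ => ∫ θ, (k + 1 : ℝ)⁻¹ *
      (g θ + (((k + 1 : ℝ)⁻¹ : ℝ) : ℂ) • 1)⁻¹.trace.re ∂circ) atTop (𝓝 0) := by
  have hpos : ∀ k : ℕ, (0 : ℝ) < (k + 1 : ℝ)⁻¹ := fun k => by positivity
  have e0 : (0 : ℝ) = ∫ _ : ℝ, 0 ∂circ := by simp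
  rw [e0]
  refine tendsto_integral_of_dominated_convergence (fun _ => Fintype.card ι)
    (fun k => (integrable_trace_inv_add_smul_one hg hpd (hpos k)).1) (integrable_const _)
    (fun k => ?_) ?_
  · filter_upwards [hpd] with θ hθ
    obtain ⟨h0, -, h1⟩ := trace_re_inv_add_smul_one_bounds (hpos k) hθ
    rwa [Real.norm_of_nonneg (mul_nonneg (hpos k).le h0)]
  · filter_upwards [hpd] with θ hθ
    have hl : Tendsto (fun k : ℕ => (k + 1 : ℝ)⁻¹ * (g θ)⁻¹.trace.re) atTop (𝓝 0) := by
      simpa using (tendsto_one_div_add_atTop_nhds_zero_nat (𝕜 := ℝ)).mul_const (g θ)⁻¹.trace.re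
    refine squeeze_zero (fun k => ?_) (fun k => ?_) hl
    · exact mul_nonneg (hpos k).le (trace_re_inv_add_smul_one_bounds (hpos k) hθ).1
    · exact mul_le_mul_of_nonneg_left (trace_re_inv_add_smul_one_bounds (hpos k) hθ).2.1
        (hpos k).le

lemma trace_schurResolvent_re_eq_sum {t : ℝ} (ht : 0 < t) (B : Matrix κ ι ℂ) {G : Matrix ι ι ℂ}
    (hG : G.PosDef) :
    (schurResolvent t B G).trace.re = ∑ i, (t + hermEig (B * G⁻¹ * Bᴴ) i)⁻¹ :=
  trace_resolvent_eq_sum (posSemidef_mul_inv_mul B hG) ht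

lemma integrable_trace_schurResolvent (hf : AEMeasEntries f circ) (hg : AEMeasEntries g circ)
    (hpd : ∀ᵐ θ ∂circ, (g θ).PosDef) {t : ℝ} (ht : 0 < t) :
    Integrable (fun θ => (schurResolvent t (f θ) (g θ)).trace.re) circ := by
  refine Integrable.of_bound (Complex.continuous_re.comp_aestronglyMeasurable
    ((aeMeasEntries_const _).add ((hf.mul hg.inv).mul hf.conjTranspose)).inv.trace)
    (Fintype.card κ * t⁻¹) ?_
  filter_upwards [hpd] with θ hθ
  rw [trace_schurResolvent_re_eq_sum ht _ hθ]
  have hl := hermEig_nonneg (posSemidef_mul_inv_mul (f θ) hθ)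
  refine (norm_sum_le _ _).trans ((Finset.sum_le_card_nsmul _ _ t⁻¹ fun i _ => ?_).trans_eq
    (by simp))
  rw [Real.norm_of_nonneg (inv_nonneg.2 (add_nonneg ht.le (hl i)))]
  exact inv_anti₀ ht (le_add_of_nonneg_right (hl i))

/-- Convergence of the resolvent traces of `T_n(f) T_n(g)⁻¹ T_n(f)ᴴ`. -/
theorem tendsto_trace_schurResolvent (hf : ∀ a b, Integrable (fun θ => f θ a b) circ)
    (hg : ∀ a b, Integrable (fun θ => g θ a b) circ) (hpd : ∀ᵐ θ ∂circ, (g θ).PosDef) {t : ℝ}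
    (ht : 0 < t) :
    Tendsto (fun n : ℕ => (n : ℝ)⁻¹ * (schurResolvent t (toep n f) (toep n g)).trace.re) atTop
      (𝓝 (∫ θ, (schurResolvent t (f θ) (g θ)).trace.re ∂circ)) := by
  have hfm : AEMeasEntries f circ := fun a b => (hf a b).1
  have hgm : AEMeasEntries g circ := fun a b => (hg a b).1
  refine tendsto_of_approx fun η hη => ?_
  have hlim := (tendsto_integral_trace_inv_add_smul_one hgm hpd).const_mul t⁻¹
  rw [mul_zero] at hlim
  obtain ⟨k, hk⟩ := (hlim.eventually (gt_mem_nhds hη)).exists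
  have hε : (0 : ℝ) < (k + 1 : ℝ)⁻¹ := by positivity
  set ε : ℝ := (k + 1 : ℝ)⁻¹
  have hpdε : ∀ᵐ θ ∂circ, (g θ + (ε : ℂ) • 1).PosDef := by
    filter_upwards [hpd] with θ hθ using hθ.add (posDef_real_smul_one hε)
  have hgε : ∀ a b, Integrable (fun θ => (g θ + (ε : ℂ) • 1) a b) circ := fun a b =>
    (hg a b).add (integrable_const _)
  have hiε := integrable_trace_inv_add_smul_one hgm hpd hε
  have hsε := integrable_trace_schurResolvent hfm (fun a b => (hgε a b).1) hpdε ht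
  refine ⟨fun n => (n : ℝ)⁻¹ *
      (schurResolvent t (toep n f) (toep n g + (ε : ℂ) • 1)).trace.re,
    ∫ θ, (schurResolvent t (f θ) (g θ + (ε : ℂ) • 1)).trace.re ∂circ, ?_,
    Eventually.of_forall fun n => ?_, ?_⟩
  · exact tendsto_trace_schurResolvent_add hf hg hpd ht hε
  · rw [dist_comm, Real.dist_eq, ← mul_sub, abs_mul, abs_of_nonneg (by positivity)]
    rcases n.eq_zero_or_pos with rfl | hn
    · simpa using hη.le
    have hnr : (0 : ℝ) < n := by exact_mod_cast hn
    rw [inv_mul_le_iff₀ hnr]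
    refine (abs_trace_schurResolvent_sub_le ht hε _ (posDef_toep n hg hpd)).trans ?_
    rw [← toep_add_smul_one hg]
    have hi1 : Integrable (fun θ => (g θ + (ε : ℂ) • 1)⁻¹.trace.re) circ := by
      simpa [hε.ne'] using hiε.const_mul ε⁻¹
    have h1 := trace_inv_toep_le hgε hpdε hi1 n
    rw [integral_const_mul] at hk
    calc _ ≤ t⁻¹ * (ε * (n * ∫ θ, (g θ + (ε : ℂ) • 1)⁻¹.trace.re ∂circ)) := by gcongr
      _ = n * (t⁻¹ * (ε * ∫ θ, (g θ + (ε : ℂ) • 1)⁻¹.trace.re ∂circ)) := by ring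
      _ ≤ n * η := by gcongr
  · rw [dist_eq_norm, ← integral_sub hsε (integrable_trace_schurResolvent hfm hgm hpd ht)]
    refine le_trans ?_ hk.le
    rw [← integral_const_mul]
    refine norm_integral_le_of_norm_le (hiε.const_mul _) ?_
    filter_upwards [hpd] with θ hθ using abs_trace_schurResolvent_sub_le ht hε _ hθ

end Schur

section MeanLimit

open scoped Topology

variable {κ : Type*} [Fintype κ] {l : (n : ℕ) → Fin n × κ → ℝ} {w : ℝ → κ → ℝ} {φ ψ : ℝ → ℝ}

/-- The means of `φ` over the families `l n` converge to the integral of `φ` along `w`. -/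
def MeanLimit (l : (n : ℕ) → Fin n × κ → ℝ) (w : ℝ → κ → ℝ) (φ : ℝ → ℝ) : Prop :=
  Integrable (fun θ => ∑ i, φ (w θ i)) circ ∧
    Tendsto (fun n : ℕ => (n : ℝ)⁻¹ * ∑ j, φ (l n j)) atTop (𝓝 (∫ θ, ∑ i, φ (w θ i) ∂circ))

lemma MeanLimit.const_mul (h : MeanLimit l w φ) (a : ℝ) : MeanLimit l w fun y => a * φ y := by
  refine ⟨by simpa only [Finset.mul_sum] using h.1.const_mul a, ?_⟩
  simp only [← Finset.mul_sum, integral_const_mul, mul_left_comm _ a]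
  exact h.2.const_mul a

lemma MeanLimit.add (h : MeanLimit l w φ) (k : MeanLimit l w ψ) :
    MeanLimit l w fun y => φ y + ψ y := by
  simp only [MeanLimit, Finset.sum_add_distrib, mul_add, integral_add h.1 k.1]
  exact ⟨h.1.add k.1, h.2.add k.2⟩

lemma MeanLimit.const (c : ℝ) : MeanLimit l w fun _ => c := by
  refine ⟨integrable_const _, tendsto_const_nhds.congr' ?_⟩
  filter_upwards [eventually_gt_atTop 0] with n hn
  have : (n : ℝ) ≠ 0 := by exact_mod_cast hn.ne'
  simp only [Finset.sum_const, Finset.card_univ, Fintype.card_prod, Fintype.card_fin, nsmul_eq_mul,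
    integral_const, probReal_univ, one_smul, Nat.cast_mul]
  field_simp

lemma abs_sum_sub_sum_le {α : Type*} [Fintype α] {y : α → ℝ} (hy : ∀ i, y i ∈ Set.Icc (0 : ℝ) 1)
    {η : ℝ} (h : ∀ x ∈ Set.Icc (0 : ℝ) 1, |ψ x - φ x| ≤ η) :
    |∑ i, ψ (y i) - ∑ i, φ (y i)| ≤ Fintype.card α * η := by
  rw [← Finset.sum_sub_distrib]
  refine (Finset.abs_sum_le_sum_abs _ _).trans
    ((Finset.sum_le_card_nsmul _ _ η fun i _ => h _ (hy i)).trans_eq ?_)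
  rw [nsmul_eq_mul, Finset.card_univ]

lemma MeanLimit.of_approx (hl : ∀ n j, l n j ∈ Set.Icc (0 : ℝ) 1)
    (hw : ∀ᵐ θ ∂circ, ∀ i, w θ i ∈ Set.Icc (0 : ℝ) 1)
    (h : ∀ η > 0, ∃ ψ, MeanLimit l w ψ ∧ ∀ x ∈ Set.Icc (0 : ℝ) 1, |ψ x - φ x| ≤ η) :
    MeanLimit l w φ := by
  have hm : AEStronglyMeasurable (fun θ => ∑ i, φ (w θ i)) circ := by
    choose! ψ h1 h2 using fun k : ℕ => h (1 / ((k : ℝ) + 1)) Nat.one_div_pos_of_nat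
    refine aestronglyMeasurable_of_tendsto_ae atTop (fun k => (h1 k).1.1) ?_
    filter_upwards [hw] with θ hθ
    rw [tendsto_iff_dist_tendsto_zero]
    refine squeeze_zero (fun _ => dist_nonneg) (fun k => abs_sum_sub_sum_le hθ (h2 k)) ?_
    simpa using (tendsto_one_div_add_atTop_nhds_zero_nat (𝕜 := ℝ)).const_mul (Fintype.card κ : ℝ)
  have hi : Integrable (fun θ => ∑ i, φ (w θ i)) circ := by
    obtain ⟨ψ, h1, h2⟩ := h 1 one_pos
    have : Integrable (fun θ => ∑ i, ψ (w θ i) - ∑ i, φ (w θ i)) circ := by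
      refine Integrable.of_bound (h1.1.1.sub hm) (Fintype.card κ * 1) ?_
      filter_upwards [hw] with θ hθ using abs_sum_sub_sum_le hθ h2
    exact (h1.1.sub this).congr (.of_forall fun θ => sub_sub_cancel _ _)
  refine ⟨hi, tendsto_of_approx fun η hη => ?_⟩
  obtain ⟨ψ, h1, h2⟩ := h (η / (Fintype.card κ + 1)) (by positivity)
  have hle : Fintype.card κ * (η / (Fintype.card κ + 1)) ≤ η := by
    rw [mul_div_assoc', div_le_iff₀ (by positivity)]
    nlinarith
  refine ⟨_, _, h1.2, Eventually.of_forall fun n => ?_, ?_⟩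
  · rw [dist_comm, Real.dist_eq, ← mul_sub, abs_mul, abs_of_nonneg (by positivity)]
    rcases n.eq_zero_or_pos with rfl | hn
    · simpa using hη.le
    rw [inv_mul_le_iff₀ (by exact_mod_cast hn)]
    refine (abs_sum_sub_sum_le (hl n) h2).trans ?_
    rw [Fintype.card_prod, Fintype.card_fin, Nat.cast_mul, mul_assoc]
    gcongr
  · rw [dist_eq_norm, ← integral_sub h1.1 hi]
    refine (norm_integral_le_of_norm_le_const (C := η) ?_).trans_eq (by simp)
    filter_upwards [hw] with θ hθ using (abs_sum_sub_sum_le hθ h2).trans hle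

lemma MeanLimit.congr (hl : ∀ n j, l n j ∈ Set.Icc (0 : ℝ) 1)
    (hw : ∀ᵐ θ ∂circ, ∀ i, w θ i ∈ Set.Icc (0 : ℝ) 1) (h : MeanLimit l w ψ)
    (he : Set.EqOn ψ φ (Set.Icc 0 1)) : MeanLimit l w φ :=
  .of_approx hl hw fun η hη => ⟨ψ, h, fun x hx => by simpa [he hx] using hη.le⟩

/-- The functions `y ^ (k + 1) / (1 + u y)` are obtained from those with `k = 0` by recursion. -/
lemma meanLimit_pow_div (hl : ∀ n j, l n j ∈ Set.Icc (0 : ℝ) 1)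
    (hw : ∀ᵐ θ ∂circ, ∀ i, w θ i ∈ Set.Icc (0 : ℝ) 1)
    (h : ∀ u, 0 ≤ u → MeanLimit l w fun y => y / (1 + u * y)) (k : ℕ) :
    ∀ u, 0 ≤ u → MeanLimit l w fun y => y ^ (k + 1) / (1 + u * y) := by
  induction k with
  | zero => simpa using h
  | succ k ih =>
    have hpos : ∀ u, 0 < u → MeanLimit l w fun y => y ^ (k + 2) / (1 + u * y) := fun u hu => by
      refine (((ih 0 le_rfl).const_mul u⁻¹).add ((ih u hu.le).const_mul (-u⁻¹))).congr hl hw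
        fun y hy => ?_
      have : 1 + u * y ≠ 0 := (add_pos_of_pos_of_nonneg one_pos (mul_nonneg hu.le hy.1)).ne'
      field_simp
      ring
    intro u hu
    rcases hu.eq_or_lt with rfl | hu
    · refine .of_approx hl hw fun η hη => ⟨_, hpos η hη, fun y hy => ?_⟩
      have h1 : 0 < 1 + η * y := add_pos_of_pos_of_nonneg one_pos (mul_nonneg hη.le hy.1)
      have h2 : y ^ (k + 2) / (1 + η * y) - y ^ (k + 2) / (1 + 0 * y) =
          -(η * (y ^ (k + 3) / (1 + η * y))) := by
        field_simp
        ring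
      have h3 : 0 ≤ y ^ (k + 3) := pow_nonneg hy.1 _
      rw [h2, abs_neg, abs_of_nonneg (by positivity)]
      refine mul_le_of_le_one_right hη.le ((div_le_one h1).2 ?_)
      exact (pow_le_one₀ hy.1 hy.2).trans (le_add_of_nonneg_right (mul_nonneg hη.le hy.1))
    · exact hpos u hu

theorem meanLimit_of_continuousOn (hl : ∀ n j, l n j ∈ Set.Icc (0 : ℝ) 1)
    (hw : ∀ᵐ θ ∂circ, ∀ i, w θ i ∈ Set.Icc (0 : ℝ) 1)
    (h : ∀ u, 0 ≤ u → MeanLimit l w fun y => y / (1 + u * y))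
    (hφ : ContinuousOn φ (Set.Icc 0 1)) : MeanLimit l w φ := by
  have hpow : ∀ k : ℕ, MeanLimit l w fun y => y ^ k
    | 0 => by simpa using MeanLimit.const (l := l) (w := w) 1
    | k + 1 => by simpa using meanLimit_pow_div hl hw h k 0 le_rfl
  have hpoly : ∀ p : Polynomial ℝ, MeanLimit l w fun y => p.eval y := fun p => by
    induction p using Polynomial.induction_on' with
    | add p q hp hq => simpa using hp.add hq
    | monomial k a => simpa using (hpow k).const_mul a
  refine .of_approx hl hw fun η hη => ?_
  obtain ⟨p, hp⟩ := exists_polynomial_near_of_continuousOn 0 1 φ hφ η hη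
  exact ⟨_, hpoly p, fun x hx => (hp x hx).le⟩

/-- Convergence of resolvent sums determines the limits against compactly supported functions. -/
theorem meanLimit_of_hasCompactSupport (hl : ∀ n j, 0 ≤ l n j)
    (hw : ∀ᵐ θ ∂circ, ∀ i, 0 ≤ w θ i)
    (h : ∀ t, 0 < t → MeanLimit l w fun x => (t + x)⁻¹)
    {F : ℝ → ℝ} (hF : Continuous F) (hFs : HasCompactSupport F) : MeanLimit l w F := by
  have hmem : ∀ x : ℝ, 0 ≤ x → (1 + x)⁻¹ ∈ Set.Icc (0 : ℝ) 1 := fun x hx =>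
    ⟨by positivity, inv_le_one_of_one_le₀ (le_add_of_nonneg_right hx)⟩
  obtain ⟨M, hM0, hM⟩ : ∃ M : ℝ, 0 ≤ M ∧ ∀ x, M ≤ x → F x = 0 := by
    obtain ⟨R, hR⟩ := hFs.isCompact.isBounded.subset_closedBall 0
    refine ⟨max (R + 1) 0, le_max_right _ _, fun x hx =>
      image_eq_zero_of_notMem_tsupport fun hx' => ?_⟩
    have h1 := hR hx'
    rw [mem_closedBall_zero_iff, Real.norm_eq_abs] at h1
    linarith [le_abs_self x, le_max_left (R + 1) 0]
  have hc : 0 < (1 + M)⁻¹ := by positivity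
  have hcont : Continuous fun y : ℝ => F ((max y (1 + M)⁻¹)⁻¹ - 1) :=
    hF.comp (((continuous_id.max continuous_const).inv₀ fun y =>
      (lt_max_of_lt_right hc).ne').sub continuous_const)
  have hFeq : ∀ x : ℝ, 0 ≤ x → F ((max (1 + x)⁻¹ (1 + M)⁻¹)⁻¹ - 1) = F x := fun x hx => by
    rcases le_total x M with hxM | hxM
    · rw [max_eq_left (by gcongr), inv_inv, add_sub_cancel_left]
    · rw [max_eq_right (by gcongr), inv_inv, add_sub_cancel_left, hM x hxM, hM M le_rfl]
  have transfer : ∀ {φ ψ : ℝ → ℝ}, (∀ x, 0 ≤ x → φ (1 + x)⁻¹ = ψ x) →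
      (MeanLimit (fun n j => (1 + l n j)⁻¹) (fun θ i => (1 + w θ i)⁻¹) φ ↔ MeanLimit l w ψ) :=
    fun {φ ψ} he => by
      have ha : (fun θ => ∑ i, φ (1 + w θ i)⁻¹) =ᵐ[circ] fun θ => ∑ i, ψ (w θ i) := by
        filter_upwards [hw] with θ hθ using Finset.sum_congr rfl fun i _ => he _ (hθ i)
      simp only [MeanLimit, integrable_congr ha, integral_congr_ae ha, fun n j => he _ (hl n j)]
  refine (transfer hFeq).1 (meanLimit_of_continuousOn (fun n j => hmem _ (hl n j)) ?_
    (fun u hu => (transfer fun x hx => ?_).2 (h (1 + u) (by positivity))) hcont.continuousOn)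
  · filter_upwards [hw] with θ hθ i using hmem _ (hθ i)
  · field_simp
    ring

end MeanLimit

section Eigenvalues

open scoped Topology

variable {κ ι : Type*} [Fintype κ] [DecidableEq κ] [Fintype ι] [DecidableEq ι]
  {f : ℝ → Matrix κ ι ℂ} {g : ℝ → Matrix ι ι ℂ}

theorem meanLimit_hermEig (hf : ∀ a b, Integrable (fun θ => f θ a b) circ)
    (hg : ∀ a b, Integrable (fun θ => g θ a b) circ) (hpd : ∀ᵐ θ ∂circ, (g θ).PosDef)
    {F : ℝ → ℝ} (hF : Continuous F) (hFs : HasCompactSupport F) :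
    MeanLimit (fun n => hermEig (toep n f * (toep n g)⁻¹ * (toep n f)ᴴ))
      (fun θ => hermEig (f θ * (g θ)⁻¹ * (f θ)ᴴ)) F := by
  refine meanLimit_of_hasCompactSupport
    (fun n => hermEig_nonneg (posSemidef_mul_inv_mul _ (posDef_toep n hg hpd))) ?_
    (fun t ht => ?_) hF hFs
  · filter_upwards [hpd] with θ hθ using hermEig_nonneg (posSemidef_mul_inv_mul _ hθ)
  · have ha : (fun θ => (schurResolvent t (f θ) (g θ)).trace.re) =ᵐ[circ]
        fun θ => ∑ i, (t + hermEig (f θ * (g θ)⁻¹ * (f θ)ᴴ) i)⁻¹ := by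
      filter_upwards [hpd] with θ hθ using trace_schurResolvent_re_eq_sum ht _ hθ
    have h := tendsto_trace_schurResolvent hf hg hpd ht
    rw [integral_congr_ae ha] at h
    refine ⟨(integrable_trace_schurResolvent (fun a b => (hf a b).1) (fun a b => (hg a b).1) hpd
      ht).congr ha, h.congr fun n => ?_⟩
    rw [trace_schurResolvent_re_eq_sum ht _ (posDef_toep n hg hpd)]

end Eigenvalues

end BlockToeplitz

/-- **Eigenvalue distribution of `T_n(f) T_n(g)⁻¹ T_n(f^*)`.**
Let `0 < q < s`, let `g : [-π,π] → ℂ^{s×s}` have integrable entries and be Hermitian positive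
definite almost everywhere, and let `f : [-π,π] → ℂ^{q×s}` have integrable entries. Then each
`T_n(g)` is Hermitian positive definite (hence invertible), each
`T_n(f) T_n(g)⁻¹ T_n(f^*)` is Hermitian of size `q·n`, and
`{T_n(f) T_n(g)⁻¹ T_n(f^*)}_n ∼_λ f·g⁻¹·f^*`. -/
theorem rect_toeplitz_inv_conj_eigenvalue_distribution
    (s q : ℕ) (hq : 0 < q) (hsq : q < s)
    (g : ℝ → Matrix (Fin s) (Fin s) ℂ) (f : ℝ → Matrix (Fin q) (Fin s) ℂ)
    (hg : ∀ a b, IntervalIntegrable (fun θ => g θ a b) volume (-Real.pi) Real.pi)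
    (hgpd : ∀ᵐ θ ∂(volume.restrict (Set.Icc (-Real.pi) Real.pi)), (g θ).PosDef)
    (hf : ∀ a b, IntervalIntegrable (fun θ => f θ a b) volume (-Real.pi) Real.pi) :
    (∀ n : ℕ, (blockToeplitz n g).PosDef ∧ IsUnit (blockToeplitz n g)) ∧
    (∀ n : ℕ,
      (blockToeplitz n f * (blockToeplitz n g)⁻¹ *
        blockToeplitz n (fun θ => (f θ)ᴴ)).IsHermitian) ∧
    (∀ F : ℝ → ℝ, Continuous F → HasCompactSupport F →
      Tendsto
        (fun n : ℕ =>
          (1 / (q * n : ℝ)) *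
            ∑ j : Fin n × Fin q,
              F (hermEig
                  (blockToeplitz n f * (blockToeplitz n g)⁻¹ *
                    blockToeplitz n (fun θ => (f θ)ᴴ)) j))
        atTop
        (nhds ((1 / (2 * Real.pi)) *
          ∫ θ in (-Real.pi)..Real.pi,
            (1 / (q : ℝ)) * ∑ i : Fin q, F (hermEig (f θ * (g θ)⁻¹ * (f θ)ᴴ) i)))) := by
  have hgi : ∀ a b, Integrable (fun θ => g θ a b) BlockToeplitz.circ := fun a b =>
    BlockToeplitz.integrable_circ (hg a b)
  have hfi : ∀ a b, Integrable (fun θ => f θ a b) BlockToeplitz.circ := fun a b =>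
    BlockToeplitz.integrable_circ (hf a b)
  have hpd := BlockToeplitz.circ_absolutelyContinuous.ae_le hgpd
  simp only [BlockToeplitz.blockToeplitz_eq_toep, BlockToeplitz.toep_conjTranspose]
  have hT := fun n => BlockToeplitz.posDef_toep n hgi hpd
  refine ⟨fun n => ⟨hT n, (hT n).isUnit⟩,
    fun n => (BlockToeplitz.posSemidef_mul_inv_mul _ (hT n)).isHermitian, fun F hF hFs => ?_⟩
  have h := (BlockToeplitz.meanLimit_hermEig hfi hgi hpd hF hFs).2.const_mul (q : ℝ)⁻¹
  rw [BlockToeplitz.integral_circ, smul_eq_mul, mul_left_comm,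
    ← intervalIntegral.integral_const_mul] at h
  simp only [← mul_assoc, ← mul_inv] at h
  simpa only [one_div] using h
end

section
/- Let {A_n}_n be a sequence of Hermitian matrices, A_n ∈ ℂ^{d_n×d_n} with d_n → ∞, and let {P_n}_n be a sequence of matrices P_n ∈ ℂ^{d_n×δ_n} with P_n^* P_n = I_{δ_n}, δ_n ≤ d_n, and δ_n/d_n → 1 as n → ∞. Let f : [a,b] → ℂ^{s×s} be a measurable matrix-valued function that is Hermitian-valued. Then {A_n}_n is distributed in the sense of the eigenvalues as f if and only if {P_n^* A_n P_n}_n (a sequence of Hermitian matrices of size δ_n) is distributed in the sense of the eigenvalues as f. -/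
open MeasureTheory Filter Matrix

/-- If every vector supported on `s` whose image under `W` vanishes on `t` is zero, then `s` has at
most as many elements as `t`. -/
theorem card_le_card_of_mulVec_eq_zero_imp {m n : Type*} [Fintype m] [Fintype n]
    (W : Matrix n m ℂ) (s : Finset m) (t : Finset n)
    (h : ∀ c : m → ℂ, (∀ j, j ∉ s → c j = 0) → (∀ i ∈ t, (W *ᵥ c) i = 0) → c = 0) :
    s.card ≤ t.card := by
  classical
  let E : (s → ℂ) →ₗ[ℂ] (m → ℂ) :=
    { toFun := fun c j => if hj : j ∈ s then c ⟨j, hj⟩ else 0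
      map_add' := by
        intro x y
        ext j
        by_cases hj : j ∈ s <;> simp [hj]
      map_smul' := by
        intro r x
        ext j
        by_cases hj : j ∈ s <;> simp [hj] }
  let T : (s → ℂ) →ₗ[ℂ] (t → ℂ) :=
    (LinearMap.funLeft ℂ ℂ (fun i : t => (i : n))).comp (W.mulVecLin.comp E)
  have hT : Function.Injective T := by
    rw [← LinearMap.ker_eq_bot, LinearMap.ker_eq_bot']
    intro c hc
    have hE : E c = 0 := by
      refine h _ (fun j hj => ?_) (fun i hi => ?_)
      · simp [E, hj]
      · exact congrFun hc ⟨i, hi⟩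
    ext j
    simpa [E] using congrFun hE j
  simpa using LinearMap.finrank_le_finrank_of_injective hT

/-- The quadratic form of a real diagonal matrix. -/
theorem star_dotProduct_diagonal_mulVec {n : Type*} [Fintype n] [DecidableEq n]
    (l : n → ℝ) (w : n → ℂ) :
    star w ⬝ᵥ (diagonal (fun i => (l i : ℂ)) *ᵥ w) = ((∑ i, l i * ‖w i‖ ^ 2 : ℝ) : ℂ) := by
  simp only [dotProduct, mulVec_diagonal, Pi.star_apply, Complex.ofReal_sum]
  refine Finset.sum_congr rfl fun i _ => ?_
  have := Complex.conj_mul' (w i)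
  push_cast
  rw [← this, RCLike.star_def]
  ring

theorem sum_mul_normSq_mulVec {m n : Type*} [Fintype m] [Fintype n] [DecidableEq m]
    [DecidableEq n] (W : Matrix n m ℂ) (l : n → ℝ) (u : m → ℝ)
    (h : Wᴴ * diagonal (fun i => (l i : ℂ)) * W = diagonal (fun j => (u j : ℂ))) (c : m → ℂ) :
    ∑ i, l i * ‖(W *ᵥ c) i‖ ^ 2 = ∑ j, u j * ‖c j‖ ^ 2 := by
  have key : star (W *ᵥ c) ⬝ᵥ (diagonal (fun i => (l i : ℂ)) *ᵥ (W *ᵥ c)) =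
      star c ⬝ᵥ (diagonal (fun j => (u j : ℂ)) *ᵥ c) := by
    rw [← h, star_mulVec, ← dotProduct_mulVec, mulVec_mulVec, mulVec_mulVec, Matrix.mul_assoc]
  rw [star_dotProduct_diagonal_mulVec, star_dotProduct_diagonal_mulVec] at key
  exact_mod_cast key

/-- Inertia comparison: compressing a diagonal form along an isometry to a diagonal form. -/
theorem card_le_and_card_lt_of_diagonal_compression {m n : Type*} [Fintype m] [Fintype n]
    [DecidableEq m] [DecidableEq n] (W : Matrix n m ℂ) (hW : Wᴴ * W = 1) (l : n → ℝ) (u : m → ℝ)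
    (h : Wᴴ * diagonal (fun i => (l i : ℂ)) * W = diagonal (fun j => (u j : ℂ))) (x : ℝ) :
    (Finset.univ.filter fun j => u j ≤ x).card ≤ (Finset.univ.filter fun i => l i ≤ x).card ∧
    (Finset.univ.filter fun j => x < u j).card ≤ (Finset.univ.filter fun i => x < l i).card := by
  have hone : ∀ c : m → ℂ, ∑ i, ‖(W *ᵥ c) i‖ ^ 2 = ∑ j, ‖c j‖ ^ 2 := by
    intro c
    simpa using sum_mul_normSq_mulVec W (fun _ => 1) (fun _ => 1) (by simpa using hW) c
  have hshift : ∀ c : m → ℂ,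
      ∑ i, (l i - x) * ‖(W *ᵥ c) i‖ ^ 2 = ∑ j, (u j - x) * ‖c j‖ ^ 2 := by
    intro c
    simp only [sub_mul, Finset.sum_sub_distrib, ← Finset.mul_sum, hone c,
      sum_mul_normSq_mulVec W l u h c]
  constructor
  · refine card_le_card_of_mulVec_eq_zero_imp W _ _ fun c hc hw => ?_
    simp only [Finset.mem_filter, Finset.mem_univ, true_and, not_le] at hc hw
    have hl : ∀ i ∈ Finset.univ, 0 ≤ (l i - x) * ‖(W *ᵥ c) i‖ ^ 2 := by
      intro i _
      rcases le_or_gt (l i) x with hi | hi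
      · simp [hw i hi]
      · exact mul_nonneg (by linarith) (by positivity)
    have hu : ∑ j, (u j - x) * ‖c j‖ ^ 2 ≤ 0 := by
      refine Finset.sum_nonpos fun j _ => ?_
      rcases le_or_gt (u j) x with hj | hj
      · exact mul_nonpos_of_nonpos_of_nonneg (by linarith) (by positivity)
      · simp [hc j hj]
    have hzero : ∑ i, (l i - x) * ‖(W *ᵥ c) i‖ ^ 2 = 0 :=
      le_antisymm ((hshift c).trans_le hu) (Finset.sum_nonneg hl)
    have hWc : ∀ i, (W *ᵥ c) i = 0 := by
      intro i
      rcases le_or_gt (l i) x with hi | hi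
      · exact hw i hi
      · have := (Finset.sum_eq_zero_iff_of_nonneg hl).1 hzero i (Finset.mem_univ i)
        simpa [(sub_pos.2 hi).ne'] using this
    have hWc' : W *ᵥ c = 0 := funext hWc
    rw [← one_mulVec c, ← hW, ← mulVec_mulVec, hWc', mulVec_zero]
  · refine card_le_card_of_mulVec_eq_zero_imp W _ _ fun c hc hw => ?_
    simp only [Finset.mem_filter, Finset.mem_univ, true_and, not_lt] at hc hw
    have hu : ∀ j ∈ Finset.univ, 0 ≤ (u j - x) * ‖c j‖ ^ 2 := by
      intro j _
      rcases le_or_gt (u j) x with hj | hj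
      · simp [hc j hj]
      · exact mul_nonneg (by linarith) (by positivity)
    have hl : ∑ i, (l i - x) * ‖(W *ᵥ c) i‖ ^ 2 ≤ 0 := by
      refine Finset.sum_nonpos fun i _ => ?_
      rcases le_or_gt (l i) x with hi | hi
      · exact mul_nonpos_of_nonpos_of_nonneg (by linarith) (by positivity)
      · simp [hw i hi]
    have hzero : ∑ j, (u j - x) * ‖c j‖ ^ 2 = 0 :=
      le_antisymm ((hshift c).symm.trans_le hl) (Finset.sum_nonneg hu)
    ext j
    rcases le_or_gt (u j) x with hj | hj
    · exact hc j hj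
    · have := (Finset.sum_eq_zero_iff_of_nonneg hu).1 hzero j (Finset.mem_univ j)
      simpa [(sub_pos.2 hj).ne'] using this

theorem hermEig_eq_eigenvalues {n : Type*} [Fintype n] [DecidableEq n] {A : Matrix n n ℂ}
    (hA : A.IsHermitian) : hermEig A = hA.eigenvalues := by
  unfold hermEig
  rw [dif_pos hA]

theorem exists_unitary_conjTranspose_mul_mul_eq_diagonal_hermEig {n : Type*} [Fintype n]
    [DecidableEq n] {A : Matrix n n ℂ} (hA : A.IsHermitian) :
    ∃ U : Matrix n n ℂ, Uᴴ * U = 1 ∧ U * Uᴴ = 1 ∧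
      Uᴴ * A * U = diagonal (fun i => (hermEig A i : ℂ)) := by
  have h1 : (hA.eigenvectorUnitary : Matrix n n ℂ)ᴴ * (hA.eigenvectorUnitary : Matrix n n ℂ) = 1 :=
    Unitary.coe_star_mul_self hA.eigenvectorUnitary
  have h2 : (hA.eigenvectorUnitary : Matrix n n ℂ) * (hA.eigenvectorUnitary : Matrix n n ℂ)ᴴ = 1 :=
    Unitary.coe_mul_star_self hA.eigenvectorUnitary
  refine ⟨hA.eigenvectorUnitary, h1, h2, ?_⟩
  rw [hermEig_eq_eigenvalues hA]
  have := hA.conjStarAlgAut_star_eigenvectorUnitary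
  rw [Unitary.conjStarAlgAut_apply] at this
  simpa [star_eq_conjTranspose, Function.comp_def] using this

/-- Cauchy interlacing in counting form. -/
theorem card_hermEig_compression {m n : Type*} [Fintype m] [Fintype n] [DecidableEq m]
    [DecidableEq n] {A : Matrix n n ℂ} (hA : A.IsHermitian) (P : Matrix n m ℂ) (hP : Pᴴ * P = 1)
    (x : ℝ) :
    (Finset.univ.filter fun j => hermEig (Pᴴ * A * P) j ≤ x).card ≤
      (Finset.univ.filter fun i => hermEig A i ≤ x).card ∧
    (Finset.univ.filter fun j => x < hermEig (Pᴴ * A * P) j).card ≤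
      (Finset.univ.filter fun i => x < hermEig A i).card := by
  have hB : (Pᴴ * A * P).IsHermitian := isHermitian_conjTranspose_mul_mul P hA
  obtain ⟨U, -, hU', hUA⟩ := exists_unitary_conjTranspose_mul_mul_eq_diagonal_hermEig hA
  obtain ⟨V, hV, -, hVB⟩ := exists_unitary_conjTranspose_mul_mul_eq_diagonal_hermEig hB
  refine card_le_and_card_lt_of_diagonal_compression (Uᴴ * P * V) ?_ _ _ ?_ x
  · calc (Uᴴ * P * V)ᴴ * (Uᴴ * P * V) = Vᴴ * (Pᴴ * (U * Uᴴ) * P) * V := by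
          simp only [conjTranspose_mul, conjTranspose_conjTranspose, Matrix.mul_assoc]
      _ = 1 := by rw [hU', Matrix.mul_one, hP, Matrix.mul_one, hV]
  · rw [← hUA, ← hVB]
    calc (Uᴴ * P * V)ᴴ * (Uᴴ * A * U) * (Uᴴ * P * V)
        = Vᴴ * (Pᴴ * ((U * Uᴴ) * A * (U * Uᴴ)) * P) * V := by
          simp only [conjTranspose_mul, conjTranspose_conjTranspose, Matrix.mul_assoc]
      _ = Vᴴ * (Pᴴ * A * P) * V := by rw [hU', Matrix.one_mul, Matrix.mul_one]

/-- Two finite families of reals whose counting functions are interlaced have comparable sums of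
any compactly supported continuous function. -/
theorem exists_abs_sum_sub_sum_le {F : ℝ → ℝ} (hF : Continuous F) (hFc : HasCompactSupport F)
    {ε : ℝ} (hε : 0 < ε) :
    ∃ C : ℝ, 0 ≤ C ∧ ∀ (p q : ℕ) (l : Fin p → ℝ) (u : Fin q → ℝ), q ≤ p →
      (∀ x, (Finset.univ.filter fun j => u j ≤ x).card ≤
          (Finset.univ.filter fun i => l i ≤ x).card ∧
        (Finset.univ.filter fun j => x < u j).card ≤
          (Finset.univ.filter fun i => x < l i).card) →
      |∑ i, F (l i) - ∑ j, F (u j)| ≤ C * ((p : ℝ) - q) + 2 * ε * p := by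
  obtain ⟨η, hη, hunif⟩ := Metric.uniformContinuous_iff.1
    (hFc.uniformContinuous_of_continuous hF) ε hε
  set r : ℝ := η / 2 with hr
  have hr0 : 0 < r := by positivity
  obtain ⟨R, hR⟩ : ∃ R : ℝ, ∀ x, R < |x| → F x = 0 := by
    obtain ⟨R, hR⟩ := hFc.isCompact.isBounded.exists_norm_le
    refine ⟨R, fun x hx => ?_⟩
    by_contra hne
    exact absurd (hR x (subset_tsupport _ hne)) (by simpa using hx)
  obtain ⟨M, hM⟩ := exists_nat_gt (R / r)
  set S : Finset ℤ := Finset.Icc (-(M : ℤ)) M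
  have hout : ∀ k : ℤ, k ∉ S → F (r * k) = 0 := by
    intro k hk
    apply hR
    have hk' : (M : ℤ) ≤ |k| := by
      by_contra hlt
      exact hk (Finset.mem_Icc.2 (abs_le.1 (not_le.1 hlt).le))
    have hk2 : (M : ℝ) ≤ |(k : ℝ)| := by exact_mod_cast hk'
    rw [abs_mul, abs_of_pos hr0]
    rw [div_lt_iff₀ hr0] at hM
    nlinarith
  have happ : ∀ x, |F x - F (r * ⌈x / r⌉)| ≤ ε := by
    intro x
    refine (hunif ?_).le
    have h1 := Int.le_ceil (x / r)
    have h2 := Int.ceil_lt_add_one (x / r)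
    rw [div_le_iff₀ hr0] at h1
    rw [← sub_lt_iff_lt_add, lt_div_iff₀ hr0] at h2
    rw [Real.dist_eq, abs_lt]
    constructor <;> nlinarith
  have hind : ∀ (x : ℝ) (k : ℤ), (if ⌈x / r⌉ = k then (1 : ℝ) else 0) =
      (if x ≤ r * k then 1 else 0) - (if x ≤ r * ((k : ℝ) - 1) then 1 else 0) := by
    intro x k
    have hle : ∀ z : ℤ, x ≤ r * z ↔ ⌈x / r⌉ ≤ z := by
      intro z
      rw [Int.ceil_le, div_le_iff₀ hr0, mul_comm]
    have h2 := hle (k - 1)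
    push_cast at h2
    simp only [h2, hle k]
    split_ifs <;> first | omega | norm_num
  have hstep : ∀ x : ℝ, F (r * ⌈x / r⌉) = ∑ k ∈ S, F (r * k) *
      ((if x ≤ r * k then 1 else 0) - (if x ≤ r * ((k : ℝ) - 1) then 1 else 0)) := by
    intro x
    simp only [← hind, mul_ite, mul_one, mul_zero, Finset.sum_ite_eq]
    split_ifs with hk
    · rfl
    · exact hout _ hk
  have hsum : ∀ (p : ℕ) (l : Fin p → ℝ), ∑ i, F (r * ⌈l i / r⌉) = ∑ k ∈ S, F (r * k) *
      (((Finset.univ.filter fun i => l i ≤ r * k).card : ℝ) -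
        (Finset.univ.filter fun i => l i ≤ r * ((k : ℝ) - 1)).card) := by
    intro p l
    simp only [hstep]
    rw [Finset.sum_comm]
    refine Finset.sum_congr rfl fun k _ => ?_
    rw [← Finset.mul_sum, Finset.sum_sub_distrib, Finset.sum_boole, Finset.sum_boole]
  have herr : ∀ (p : ℕ) (l : Fin p → ℝ),
      |∑ i, F (l i) - ∑ i, F (r * ⌈l i / r⌉)| ≤ ε * p := by
    intro p l
    rw [← Finset.sum_sub_distrib]
    refine (Finset.abs_sum_le_sum_abs _ _).trans ?_
    refine (Finset.sum_le_sum fun i _ => happ (l i)).trans ?_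
    simp [mul_comm]
  refine ⟨∑ k ∈ S, |F (r * k)|, Finset.sum_nonneg fun _ _ => abs_nonneg _, ?_⟩
  intro p q l u hqp hcard
  have hN : ∀ x, (0 : ℝ) ≤ ((Finset.univ.filter fun i => l i ≤ x).card : ℝ) -
        (Finset.univ.filter fun j => u j ≤ x).card ∧
      ((Finset.univ.filter fun i => l i ≤ x).card : ℝ) -
        (Finset.univ.filter fun j => u j ≤ x).card ≤ (p : ℝ) - q := by
    intro x
    obtain ⟨h1, h2⟩ := hcard x
    have hp := Finset.card_filter_add_card_filter_not (s := (Finset.univ : Finset (Fin p)))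
      (fun i => l i ≤ x)
    have hq := Finset.card_filter_add_card_filter_not (s := (Finset.univ : Finset (Fin q)))
      (fun j => u j ≤ x)
    simp only [not_le, Finset.card_univ, Fintype.card_fin] at hp hq
    have hp' : ((Finset.univ.filter fun i => l i ≤ x).card : ℝ) +
      (Finset.univ.filter fun i => x < l i).card = p := by exact_mod_cast hp
    have hq' : ((Finset.univ.filter fun j => u j ≤ x).card : ℝ) +
      (Finset.univ.filter fun j => x < u j).card = q := by exact_mod_cast hq
    have h1' : ((Finset.univ.filter fun j => u j ≤ x).card : ℝ) ≤
      (Finset.univ.filter fun i => l i ≤ x).card := by exact_mod_cast h1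
    have h2' : ((Finset.univ.filter fun j => x < u j).card : ℝ) ≤
      (Finset.univ.filter fun i => x < l i).card := by exact_mod_cast h2
    constructor <;> linarith
  have hmid : |∑ i, F (r * ⌈l i / r⌉) - ∑ j, F (r * ⌈u j / r⌉)| ≤
      (∑ k ∈ S, |F (r * k)|) * ((p : ℝ) - q) := by
    rw [hsum, hsum, ← Finset.sum_sub_distrib, Finset.sum_mul]
    refine (Finset.abs_sum_le_sum_abs _ _).trans (Finset.sum_le_sum fun k _ => ?_)
    rw [← mul_sub, abs_mul]
    refine mul_le_mul_of_nonneg_left ?_ (abs_nonneg _)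
    obtain ⟨h1, h2⟩ := hN (r * k)
    obtain ⟨h3, h4⟩ := hN (r * ((k : ℝ) - 1))
    rw [abs_le]
    constructor <;> linarith
  have hqp' : (q : ℝ) ≤ p := by exact_mod_cast hqp
  have hl := abs_le.1 (herr p l)
  have hu := abs_le.1 (herr q u)
  have hm := abs_le.1 hmid
  have hεq : ε * q ≤ ε * p := mul_le_mul_of_nonneg_left hqp' hε.le
  rw [abs_le]
  constructor <;> linarith [hl.1, hl.2, hu.1, hu.2, hm.1, hm.2]

/-- **Extradimensional (compression) theorem.** Let `{A_n}_n` be Hermitian matrices of sizes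
`d_n → ∞` and `{P_n}_n` with `P_n ∈ ℂ^{d_n × δ_n}`, `P_n^* P_n = I`, `δ_n ≤ d_n` and
`δ_n / d_n → 1`. For a measurable Hermitian-matrix-valued `f : [a,b] → ℂ^{s×s}`,
`{A_n}_n ∼_λ f` if and only if `{P_n^* A_n P_n}_n ∼_λ f`. -/
theorem compression_eigenvalue_distribution_iff
    (s : ℕ) (hs : 0 < s) (a b : ℝ) (hab : a < b)
    (f : ℝ → Matrix (Fin s) (Fin s) ℂ)
    (hfm : ∀ i j, Measurable fun t => f t i j)
    (hfH : ∀ t, (f t).IsHermitian)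
    (d δ : ℕ → ℕ)
    (A : ∀ n : ℕ, Matrix (Fin (d n)) (Fin (d n)) ℂ)
    (hA : ∀ n, (A n).IsHermitian)
    (P : ∀ n : ℕ, Matrix (Fin (d n)) (Fin (δ n)) ℂ)
    (hP : ∀ n, (P n)ᴴ * P n = 1)
    (hδd : ∀ n, δ n ≤ d n)
    (hd : Tendsto (fun n => (d n : ℝ)) atTop atTop)
    (hratio : Tendsto (fun n => (δ n : ℝ) / (d n : ℝ)) atTop (nhds 1)) :
    (∀ F : ℝ → ℝ, Continuous F → HasCompactSupport F →
      Tendsto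
        (fun n : ℕ => (1 / (d n : ℝ)) * ∑ j : Fin (d n), F (hermEig (A n) j))
        atTop
        (nhds ((1 / (b - a)) *
          ∫ t in a..b, (1 / (s : ℝ)) * ∑ i : Fin s, F (hermEig (f t) i)))) ↔
    (∀ F : ℝ → ℝ, Continuous F → HasCompactSupport F →
      Tendsto
        (fun n : ℕ =>
          (1 / (δ n : ℝ)) * ∑ j : Fin (δ n), F (hermEig ((P n)ᴴ * A n * P n) j))
        atTop
        (nhds ((1 / (b - a)) *
          ∫ t in a..b, (1 / (s : ℝ)) * ∑ i : Fin s, F (hermEig (f t) i)))) := by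
  refine forall_congr' fun F => forall_congr' fun hF => forall_congr' fun hFc => ?_
  generalize (1 / (b - a)) * ∫ t in a..b, (1 / (s : ℝ)) * ∑ i : Fin s, F (hermEig (f t) i) = L
  have hdiff : Tendsto (fun n : ℕ => (1 / (d n : ℝ)) * ∑ j : Fin (d n), F (hermEig (A n) j) -
      ((1 / (δ n : ℝ)) * ∑ j : Fin (δ n), F (hermEig ((P n)ᴴ * A n * P n) j)) *
        ((δ n : ℝ) / (d n : ℝ))) atTop (nhds 0) := by
    rw [Metric.tendsto_nhds]
    intro ε hε
    obtain ⟨C, hC0, hC⟩ := exists_abs_sum_sub_sum_le hF hFc (ε := ε / 4) (by positivity)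
    have hsmall : Tendsto (fun n => C * (1 - (δ n : ℝ) / (d n : ℝ))) atTop (nhds 0) := by
      simpa using (hratio.const_sub 1).const_mul C
    filter_upwards [hsmall.eventually_lt_const (half_pos hε), hd.eventually_gt_atTop 0]
      with n hn hdn
    have hbound := hC (d n) (δ n) _ _ (hδd n) (card_hermEig_compression (hA n) (P n) (hP n))
    have hcancel : ((1 / (δ n : ℝ)) * ∑ j : Fin (δ n), F (hermEig ((P n)ᴴ * A n * P n) j)) *
        ((δ n : ℝ) / (d n : ℝ)) =
        (1 / (d n : ℝ)) * ∑ j : Fin (δ n), F (hermEig ((P n)ᴴ * A n * P n) j) := by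
      rcases Nat.eq_zero_or_pos (δ n) with h0 | hpos
      · have : IsEmpty (Fin (δ n)) := by rw [h0]; infer_instance
        simp
      · have : (δ n : ℝ) ≠ 0 := by exact_mod_cast hpos.ne'
        field_simp
    rw [Real.dist_eq, sub_zero, hcancel, ← mul_sub, abs_mul, abs_of_pos (by positivity)]
    calc _ ≤ (1 / (d n : ℝ)) * (C * ((d n : ℝ) - δ n) + 2 * (ε / 4) * d n) :=
          mul_le_mul_of_nonneg_left hbound (by positivity)
      _ = C * (1 - (δ n : ℝ) / (d n : ℝ)) + ε / 2 := by
          field_simp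
          ring
      _ < ε := by linarith
  constructor
  · intro h
    have h1 := (h.sub hdiff).div hratio one_ne_zero
    rw [sub_zero, div_one] at h1
    refine h1.congr' ?_
    filter_upwards [hratio.eventually_ne one_ne_zero] with n hn
    simp only [Pi.div_apply, sub_sub_cancel]
    rw [mul_div_assoc, div_self hn, mul_one]
  · intro h
    have h1 := hdiff.add (h.mul hratio)
    rw [zero_add, mul_one] at h1
    exact h1.congr fun n => sub_add_cancel _ _
end

section
/- Let {X_n}_n and {Y_n}_n be sequences of matrices with X_n, Y_n ∈ ℂ^{d_n×d_n}, d_n → ∞. Assume that (a) each X_n is Hermitian and {X_n}_n is distributed in the sense of the eigenvalues as a measurable function f : [a,b] → ℂ^{s×s}, and (b) ‖Y_n‖_F = o(√{d_n}) as n → ∞, where ‖·‖_F is the Frobenius norm. Then {X_n + Y_n}_n is distributed in the sense of the eigenvalues as f: for every continuous F : ℂ → ℝ with compact support, lim_{n→∞} (1/d_n) Σ_{λ ∈ spec(X_n+Y_n)} F(λ) = (1/(b−a)) ∫_a^b (1/s) Σ_{i=1}^{s} F(λ_i(f(t))) dt, where the sum runs over the roots of the characteristic polynomial of X_n + Y_n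 counted with multiplicity. -/
open MeasureTheory Filter Matrix Asymptotics

/-- `eigSumC F A` is the sum of `F` over the eigenvalues of the complex square matrix `A`,
i.e. over the roots (with multiplicity) of its characteristic polynomial. -/
noncomputable def eigSumC {n : Type*} [Fintype n] [DecidableEq n]
    (F : ℂ → ℝ) (A : Matrix n n ℂ) : ℝ :=
  (A.charpoly.roots.map F).sum

/-- The Frobenius norm of a complex matrix. -/
noncomputable def frobNorm {m n : Type*} [Fintype m] [Fintype n] (A : Matrix m n ℂ) : ℝ :=
  Real.sqrt (∑ i, ∑ j, ‖A i j‖ ^ 2)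

/-- A unit vector is the first column of some unitary matrix. -/
theorem exists_unitary_col_zero {n : ℕ} (v : EuclideanSpace ℂ (Fin (n + 1))) (hv : ‖v‖ = 1) :
    ∃ U ∈ unitaryGroup (Fin (n + 1)) ℂ, ∀ i, U i 0 = v i := by
  have horth : Orthonormal ℂ (({0} : Set (Fin (n + 1))).domRestrict fun _ => v) := by
    refine ⟨fun _ => hv, fun i j hij => absurd (Subsingleton.elim i j) hij⟩
  obtain ⟨b, hb⟩ := horth.exists_orthonormalBasis_extension_of_card_eq (by simp)
  refine ⟨_, (EuclideanSpace.basisFun (Fin (n + 1)) ℂ).toMatrix_orthonormalBasis_mem_unitary b,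
    fun i => ?_⟩
  simp [Module.Basis.toMatrix_apply, hb 0 rfl]

/-- A complex matrix of positive size is unitarily similar to one whose first column vanishes
below the diagonal. -/
theorem exists_unitary_conj_col_zero {n : ℕ} (A : Matrix (Fin (n + 1)) (Fin (n + 1)) ℂ) :
    ∃ U ∈ unitaryGroup (Fin (n + 1)) ℂ, ∀ i : Fin n, (Uᴴ * A * U) i.succ 0 = 0 := by
  obtain ⟨μ, hμ⟩ := Module.End.exists_eigenvalue (toEuclideanLin A)
  obtain ⟨w, hw⟩ := hμ.exists_hasEigenvector
  set v : EuclideanSpace ℂ (Fin (n + 1)) := ((‖w‖⁻¹ : ℝ) : ℂ) • w with hv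
  have hv1 : ‖v‖ = 1 := by
    rw [hv, norm_smul]
    simp [hw.2]
  have hAv : toEuclideanLin A v = μ • v := by
    rw [hv, map_smul, hw.apply_eq_smul, smul_comm]
  obtain ⟨U, hU, hcol⟩ := exists_unitary_col_zero v hv1
  refine ⟨U, hU, fun i => ?_⟩
  have hAU : ∀ k, (A * U) k 0 = μ * U k 0 := fun k => by
    have := congrArg (fun x : EuclideanSpace ℂ (Fin (n + 1)) => x k) hAv
    simpa [mul_apply, hcol, mulVec, dotProduct, toLpLin_apply] using this
  have hUU := congrFun (congrFun (mem_unitaryGroup_iff'.mp hU) i.succ) 0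
  rw [mul_apply] at hUU
  rw [Matrix.mul_assoc, mul_apply]
  simp_rw [hAU, mul_left_comm _ μ]
  rw [← Finset.mul_sum, ← star_eq_conjTranspose, hUU]
  simp [Fin.succ_ne_zero]

/-- **Schur triangularization**. -/
theorem exists_unitary_conj_isUpperTriangular {n : ℕ} (A : Matrix (Fin n) (Fin n) ℂ) :
    ∃ U ∈ unitaryGroup (Fin n) ℂ, (Uᴴ * A * U).IsUpperTriangular := by
  induction n with
  | zero => exact ⟨1, one_mem _, fun i => i.elim0⟩
  | succ n ih =>
    obtain ⟨U₀, hU₀, hcol⟩ := exists_unitary_conj_col_zero A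
    set B := U₀ᴴ * A * U₀ with hB
    obtain ⟨U₁, hU₁, htri⟩ := ih (B.submatrix Fin.succ Fin.succ)
    let W : Matrix (Fin (n + 1)) (Fin (n + 1)) ℂ :=
      of (Fin.cases (Fin.cases 1 fun _ => 0) fun i => Fin.cases 0 (U₁ i))
    have hW00 : W 0 0 = 1 := rfl
    have hW0s : ∀ j : Fin n, W 0 j.succ = 0 := fun _ => rfl
    have hWs0 : ∀ i : Fin n, W i.succ 0 = 0 := fun _ => rfl
    have hWss : ∀ i j : Fin n, W i.succ j.succ = U₁ i j := fun _ _ => rfl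
    have hW : W ∈ unitaryGroup (Fin (n + 1)) ℂ := by
      rw [mem_unitaryGroup_iff'] at hU₁ ⊢
      ext i j
      refine Fin.cases ?_ (fun i => ?_) i <;> refine Fin.cases ?_ (fun j => ?_) j
      · simp [mul_apply, Fin.sum_univ_succ, star_apply, hW00, hWs0]
      · simp [mul_apply, Fin.sum_univ_succ, star_apply, hW0s, hWs0, one_apply,
          (Fin.succ_ne_zero _).symm]
      · simp [mul_apply, Fin.sum_univ_succ, star_apply, hW0s, hWs0, one_apply, Fin.succ_ne_zero]
      · have := congrFun (congrFun hU₁ i) j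
        simpa [mul_apply, Fin.sum_univ_succ, star_apply, hW0s, hWss, one_apply] using this
    refine ⟨U₀ * W, mul_mem hU₀ hW, ?_⟩
    have hconj : (U₀ * W)ᴴ * A * (U₀ * W) = Wᴴ * (B * W) := by
      simp only [hB, conjTranspose_mul, Matrix.mul_assoc]
    rw [hconj]
    intro i j hij
    revert hij
    refine Fin.cases ?_ (fun i => ?_) i <;> refine Fin.cases ?_ (fun j => ?_) j
    · simp
    · simp
    · intro _
      simp [mul_apply, Fin.sum_univ_succ, hW0s, hWs0, hcol]
    · intro hij
      have := htri (i := i) (j := j) (by simpa using hij)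
      rw [Matrix.mul_assoc] at this
      simpa [mul_apply, Fin.sum_univ_succ, hW0s, hWss] using this

theorem frobNorm_sq {m n : Type*} [Fintype m] [Fintype n] (A : Matrix m n ℂ) :
    frobNorm A ^ 2 = ∑ i, ∑ j, ‖A i j‖ ^ 2 :=
  Real.sq_sqrt (by positivity)

theorem ofReal_frobNorm_sq {m n : Type*} [Fintype m] [Fintype n] (A : Matrix m n ℂ) :
    ((frobNorm A ^ 2 : ℝ) : ℂ) = (Aᴴ * A).trace := by
  rw [frobNorm_sq, Finset.sum_comm]
  simp [trace, mul_apply, Complex.conj_mul']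

theorem frobNorm_sq_unitary_mul {n : Type*} [Fintype n] [DecidableEq n] {U : Matrix n n ℂ}
    (hU : U ∈ unitaryGroup n ℂ) (A : Matrix n n ℂ) : frobNorm (U * A) ^ 2 = frobNorm A ^ 2 := by
  have h : Uᴴ * U = 1 := mem_unitaryGroup_iff'.mp hU
  rw [← Complex.ofReal_inj, ofReal_frobNorm_sq, ofReal_frobNorm_sq, conjTranspose_mul,
    Matrix.mul_assoc, ← Matrix.mul_assoc Uᴴ, h, Matrix.one_mul]

theorem frobNorm_sq_mul_unitary {n : Type*} [Fintype n] [DecidableEq n] {U : Matrix n n ℂ}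
    (hU : U ∈ unitaryGroup n ℂ) (A : Matrix n n ℂ) : frobNorm (A * U) ^ 2 = frobNorm A ^ 2 := by
  have h : U * Uᴴ = 1 := mem_unitaryGroup_iff.mp hU
  rw [← Complex.ofReal_inj, ofReal_frobNorm_sq, ofReal_frobNorm_sq, conjTranspose_mul,
    trace_mul_comm, Matrix.mul_assoc, ← Matrix.mul_assoc U, h, Matrix.one_mul, trace_mul_comm]

theorem sum_norm_sq_row_of_mem_unitaryGroup {n : Type*} [Fintype n] [DecidableEq n]
    {U : Matrix n n ℂ} (hU : U ∈ unitaryGroup n ℂ) (i : n) : ∑ j, ‖U i j‖ ^ 2 = 1 := by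
  have h := congrFun (congrFun (mem_unitaryGroup_iff.mp hU) i) i
  rw [← Complex.ofReal_inj]
  simpa [mul_apply, star_apply, Complex.mul_conj'] using h

theorem sum_norm_sq_col_of_mem_unitaryGroup {n : Type*} [Fintype n] [DecidableEq n]
    {U : Matrix n n ℂ} (hU : U ∈ unitaryGroup n ℂ) (j : n) : ∑ i, ‖U i j‖ ^ 2 = 1 := by
  have h := congrFun (congrFun (mem_unitaryGroup_iff'.mp hU) j) j
  rw [← Complex.ofReal_inj]
  simpa [mul_apply, star_apply, Complex.conj_mul'] using h

theorem eigSumC_unitary_conj {n : Type*} [Fintype n] [DecidableEq n] {U : Matrix n n ℂ}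
    (hU : U ∈ unitaryGroup n ℂ) (F : ℂ → ℝ) (A : Matrix n n ℂ) :
    eigSumC F (Uᴴ * A * U) = eigSumC F A := by
  have h : U * Uᴴ = 1 := mem_unitaryGroup_iff.mp hU
  rw [eigSumC, charpoly_mul_comm, ← Matrix.mul_assoc, h, Matrix.one_mul, eigSumC]

theorem eigSumC_of_isUpperTriangular {n : Type*} [Fintype n] [DecidableEq n] [LinearOrder n]
    (F : ℂ → ℝ) {T : Matrix n n ℂ} (hT : T.IsUpperTriangular) :
    eigSumC F T = ∑ i, F (T i i) := by
  have hch : T.charpoly = ∏ i, (Polynomial.X - Polynomial.C (T i i)) := by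
    convert charpoly_of_isUpperTriangular T hT
  rw [eigSumC, hch, Polynomial.roots_prod _ _
    (by simp [Finset.prod_ne_zero_iff, Polynomial.X_sub_C_ne_zero])]
  simp

theorem eigSumC_of_isHermitian {n : Type*} [Fintype n] [DecidableEq n]
    (F : ℂ → ℝ) {A : Matrix n n ℂ} (hA : A.IsHermitian) :
    eigSumC F A = ∑ i, F (hA.eigenvalues i) := by
  rw [eigSumC, hA.roots_charpoly_eq_eigenvalues]
  simp

/-- If `X + Y` is upper triangular with `X` Hermitian, then `X` differs from the diagonal part of
`X + Y` by at most `√2 ‖Y‖_F` in Frobenius norm. -/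
theorem frobNorm_sq_diagonal_sub_le {n : Type*} [Fintype n] [DecidableEq n] [LinearOrder n]
    {X Y : Matrix n n ℂ} (hX : X.IsHermitian) (hT : (X + Y).IsUpperTriangular) :
    frobNorm (diagonal (fun i => (X + Y) i i) - X) ^ 2 ≤ 2 * frobNorm Y ^ 2 := by
  have hlow : ∀ i j, j < i → X i j = -Y i j := fun i j hij =>
    eq_neg_of_add_eq_zero_left (hT hij)
  have hentry : ∀ i j, ‖(diagonal (fun i => (X + Y) i i) - X) i j‖ ^ 2
      ≤ ‖Y i j‖ ^ 2 + ‖Y j i‖ ^ 2 := fun i j => by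
    rcases lt_trichotomy i j with hij | rfl | hij
    · have : ‖X i j‖ = ‖Y j i‖ := by
        rw [← hX.apply i j, norm_star, hlow j i hij, norm_neg]
      simp [diagonal_apply_ne _ hij.ne, this]
    · simp
    · simp [diagonal_apply_ne _ hij.ne', hlow i j hij]
  calc frobNorm (diagonal (fun i => (X + Y) i i) - X) ^ 2
      ≤ ∑ i, ∑ j, (‖Y i j‖ ^ 2 + ‖Y j i‖ ^ 2) := by
        rw [frobNorm_sq]
        exact Finset.sum_le_sum fun i _ => Finset.sum_le_sum fun j _ => hentry i j
    _ = 2 * frobNorm Y ^ 2 := by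
        simp_rw [Finset.sum_add_distrib]
        rw [Finset.sum_comm (f := fun i j => ‖Y j i‖ ^ 2), frobNorm_sq, two_mul]

/-- A weak form of the Hoffman–Wielandt inequality: the matrix of squared distances between the
diagonal entries `l` and the eigenvalues of a Hermitian matrix `X`, averaged against a doubly
stochastic matrix, is controlled by the Frobenius distance. -/
theorem exists_unitary_sum_norm_sq_sub_eigenvalues {n : Type*} [Fintype n] [DecidableEq n]
    {X : Matrix n n ℂ} (hX : X.IsHermitian) (l : n → ℂ) :
    ∃ V ∈ unitaryGroup n ℂ, ∑ i, ∑ j, ‖V i j‖ ^ 2 * ‖l i - hX.eigenvalues j‖ ^ 2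
      = frobNorm (diagonal l - X) ^ 2 := by
  set V : Matrix n n ℂ := (hX.eigenvectorUnitary : Matrix n n ℂ)
  have hV : V ∈ unitaryGroup n ℂ := hX.eigenvectorUnitary.2
  have hVV : Vᴴ * V = 1 := mem_unitaryGroup_iff'.mp hV
  have hXV : X * V = V * diagonal (fun j => (hX.eigenvalues j : ℂ)) := by
    conv_lhs => rw [hX.spectral_theorem, Unitary.conjStarAlgAut_apply]
    rw [Matrix.mul_assoc]
    change _ * (Vᴴ * V) = _
    rw [hVV, Matrix.mul_one]
    rfl
  refine ⟨V, hV, ?_⟩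
  rw [← frobNorm_sq_mul_unitary hV, Matrix.sub_mul, hXV, frobNorm_sq]
  refine Finset.sum_congr rfl fun i _ => Finset.sum_congr rfl fun j _ => ?_
  rw [Matrix.sub_apply, diagonal_mul, mul_diagonal, mul_comm (V i j), ← sub_mul, norm_mul, mul_pow,
    mul_comm]

/-- Averages of `F` over two families differ by at most an average difference along any doubly
stochastic coupling. -/
theorem abs_sum_sub_sum_le_of_modulus {n : Type*} [Fintype n] [DecidableEq n]
    {V : Matrix n n ℂ} (hV : V ∈ unitaryGroup n ℂ) {F : ℂ → ℝ} {ε C : ℝ}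
    (hF : ∀ z w, |F z - F w| ≤ ε + C * ‖z - w‖ ^ 2) (l m : n → ℂ) :
    |∑ i, F (l i) - ∑ j, F (m j)|
      ≤ ε * Fintype.card n + C * ∑ i, ∑ j, ‖V i j‖ ^ 2 * ‖l i - m j‖ ^ 2 := by
  have hl : ∑ i, F (l i) = ∑ i, ∑ j, ‖V i j‖ ^ 2 * F (l i) := by
    simp_rw [← Finset.sum_mul, sum_norm_sq_row_of_mem_unitaryGroup hV, one_mul]
  have hm : ∑ j, F (m j) = ∑ i, ∑ j, ‖V i j‖ ^ 2 * F (m j) := by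
    rw [Finset.sum_comm]
    simp_rw [← Finset.sum_mul, sum_norm_sq_col_of_mem_unitaryGroup hV, one_mul]
  have hε : ε * Fintype.card n = ∑ i, ∑ j, ‖V i j‖ ^ 2 * ε := by
    simp_rw [← Finset.sum_mul, sum_norm_sq_row_of_mem_unitaryGroup hV]
    simp [mul_comm]
  rw [hl, hm, hε]
  simp_rw [Finset.mul_sum, ← Finset.sum_sub_distrib, ← Finset.sum_add_distrib]
  refine (Finset.abs_sum_le_sum_abs _ _).trans (Finset.sum_le_sum fun i _ =>
    (Finset.abs_sum_le_sum_abs _ _).trans (Finset.sum_le_sum fun j _ => ?_))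
  rw [← mul_sub, abs_mul, abs_of_nonneg (by positivity)]
  calc ‖V i j‖ ^ 2 * |F (l i) - F (m j)|
      ≤ ‖V i j‖ ^ 2 * (ε + C * ‖l i - m j‖ ^ 2) := by gcongr; exact hF _ _
    _ = _ := by ring

theorem abs_eigSumC_add_sub_le {n : ℕ} {X : Matrix (Fin n) (Fin n) ℂ} (hX : X.IsHermitian)
    (Y : Matrix (Fin n) (Fin n) ℂ) {F : ℂ → ℝ} {ε C : ℝ} (hC : 0 ≤ C)
    (hF : ∀ z w, |F z - F w| ≤ ε + C * ‖z - w‖ ^ 2) :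
    |eigSumC F (X + Y) - eigSumC F X| ≤ ε * n + C * (2 * frobNorm Y ^ 2) := by
  obtain ⟨U, hU, hT⟩ := exists_unitary_conj_isUpperTriangular (X + Y)
  have hUs : Uᴴ ∈ unitaryGroup (Fin n) ℂ := Unitary.star_mem hU
  have hXU : (Uᴴ * X * U).IsHermitian := isHermitian_conjTranspose_mul_mul U hX
  have hsplit : Uᴴ * (X + Y) * U = Uᴴ * X * U + Uᴴ * Y * U := by
    rw [Matrix.mul_add, Matrix.add_mul]
  have hY : frobNorm (Uᴴ * Y * U) ^ 2 = frobNorm Y ^ 2 := by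
    rw [frobNorm_sq_mul_unitary hU, frobNorm_sq_unitary_mul hUs]
  rw [← eigSumC_unitary_conj hU F (X + Y), ← eigSumC_unitary_conj hU F X,
    eigSumC_of_isUpperTriangular F hT, eigSumC_of_isHermitian F hXU]
  rw [hsplit] at hT ⊢
  obtain ⟨V, hV, hsum⟩ := exists_unitary_sum_norm_sq_sub_eigenvalues hXU
    fun i => (Uᴴ * X * U + Uᴴ * Y * U) i i
  refine (abs_sum_sub_sum_le_of_modulus hV hF _ _).trans ?_
  rw [hsum, Fintype.card_fin, ← hY]
  gcongr
  exact frobNorm_sq_diagonal_sub_le hXU hT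

/-- A continuous compactly supported function has a quadratic modulus of continuity up to an
arbitrarily small error. -/
theorem exists_quadratic_modulus {F : ℂ → ℝ} (hF : Continuous F) (hFc : HasCompactSupport F)
    {ε : ℝ} (hε : 0 < ε) :
    ∃ C, 0 ≤ C ∧ ∀ z w, |F z - F w| ≤ ε + C * ‖z - w‖ ^ 2 := by
  obtain ⟨M, hM⟩ := hFc.exists_bound_of_continuous hF
  have hM0 : 0 ≤ M := (norm_nonneg _).trans (hM 0)
  obtain ⟨δ, hδ, hFδ⟩ :=
    Metric.uniformContinuous_iff.mp (hFc.uniformContinuous_of_continuous hF) ε hε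
  refine ⟨2 * M / δ ^ 2, by positivity, fun z w => ?_⟩
  rcases lt_or_ge (dist z w) δ with h | h
  · have := hFδ h
    rw [Real.dist_eq] at this
    have : 0 ≤ 2 * M / δ ^ 2 * ‖z - w‖ ^ 2 := by positivity
    linarith
  · have h1 : |F z - F w| ≤ 2 * M := by
      have := (abs_sub (F z) (F w)).trans (add_le_add (hM z) (hM w))
      linarith
    have h2 : 2 * M ≤ 2 * M / δ ^ 2 * ‖z - w‖ ^ 2 := by
      rw [dist_eq_norm] at h
      rw [div_mul_eq_mul_div, le_div_iff₀ (by positivity)]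
      gcongr
    linarith

/-- **Perturbation of Hermitian matrix-sequences by small Frobenius-norm corrections.**
If `X_n` are Hermitian with `{X_n}_n ∼_λ f` and `‖Y_n‖_F = o(√d_n)`, then
`{X_n + Y_n}_n ∼_λ f`, where the eigenvalues of the (possibly non-Hermitian) matrices
`X_n + Y_n` are the roots of their characteristic polynomials counted with multiplicity. -/
theorem hermitian_plus_small_frobenius_eigenvalue_distribution
    (s : ℕ) (hs : 0 < s) (a b : ℝ) (hab : a < b)
    (f : ℝ → Matrix (Fin s) (Fin s) ℂ)
    (hfm : ∀ i j, Measurable fun t => f t i j)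
    (d : ℕ → ℕ)
    (hd : Tendsto (fun n => (d n : ℝ)) atTop atTop)
    (X Y : ∀ n : ℕ, Matrix (Fin (d n)) (Fin (d n)) ℂ)
    (hX : ∀ n, (X n).IsHermitian)
    (hXdistr : ∀ F : ℂ → ℝ, Continuous F → HasCompactSupport F →
      Tendsto (fun n : ℕ => (1 / (d n : ℝ)) * eigSumC F (X n)) atTop
        (nhds ((1 / (b - a)) * ∫ t in a..b, (1 / (s : ℝ)) * eigSumC F (f t))))
    (hY : (fun n : ℕ => frobNorm (Y n)) =o[atTop] fun n : ℕ => Real.sqrt (d n)) :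
    ∀ F : ℂ → ℝ, Continuous F → HasCompactSupport F →
      Tendsto (fun n : ℕ => (1 / (d n : ℝ)) * eigSumC F (X n + Y n)) atTop
        (nhds ((1 / (b - a)) * ∫ t in a..b, (1 / (s : ℝ)) * eigSumC F (f t))) := by
  intro F hF hFc
  suffices h : Tendsto (fun n : ℕ => (1 / (d n : ℝ)) * eigSumC F (X n + Y n)
      - (1 / (d n : ℝ)) * eigSumC F (X n)) atTop (nhds 0) by
    simpa using h.add (hXdistr F hF hFc)
  rw [Metric.tendsto_nhds]
  intro ε hε
  obtain ⟨C, hC, hFC⟩ := exists_quadratic_modulus hF hFc (half_pos hε)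
  obtain ⟨c, hc, hcC⟩ : ∃ c : ℝ, 0 < c ∧ C * (2 * c ^ 2) < ε / 2 := by
    have hlim : Tendsto (fun c : ℝ => C * (2 * c ^ 2)) (nhdsWithin 0 (Set.Ioi 0)) (nhds 0) := by
      have : Continuous fun c : ℝ => C * (2 * c ^ 2) := by fun_prop
      simpa using (this.tendsto 0).mono_left nhdsWithin_le_nhds
    obtain ⟨c, h1, h2⟩ := ((hlim.eventually_lt_const (half_pos hε)).and
      self_mem_nhdsWithin).exists
    exact ⟨c, h2, h1⟩
  filter_upwards [hY.def hc, hd.eventually_gt_atTop 0] with n hn hdn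
  have hYn : frobNorm (Y n) ^ 2 ≤ c ^ 2 * d n := by
    rw [Real.norm_of_nonneg (Real.sqrt_nonneg _)] at hn
    calc frobNorm (Y n) ^ 2 ≤ (c * Real.sqrt (d n)) ^ 2 :=
          pow_le_pow_left₀ (Real.sqrt_nonneg _) ((le_abs_self _).trans hn) 2
      _ = c ^ 2 * d n := by rw [mul_pow, Real.sq_sqrt hdn.le]
  rw [Real.dist_eq, sub_zero, ← mul_sub, abs_mul, abs_of_pos (by positivity), one_div_mul_eq_div,
    div_lt_iff₀ hdn]
  calc |eigSumC F (X n + Y n) - eigSumC F (X n)|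
      ≤ ε / 2 * d n + C * (2 * frobNorm (Y n) ^ 2) := abs_eigSumC_add_sub_le (hX n) (Y n) hC hFC
    _ ≤ ε / 2 * d n + C * (2 * (c ^ 2 * d n)) := by gcongr
    _ = (ε / 2 + C * (2 * c ^ 2)) * d n := by ring
    _ < ε * d n := by
        gcongr
        linarith
end

section
/- Fix real parameters d, μ, c > 0 and set a = 105/2016 (= 5/96). Let g_0 = [[3,1],[3,1],[1,3],[1,3]], 𝔤(θ) = (3/64)·d·g_0·(1 − e^{iθ}), 𝔡(θ) = 𝔤(θ)^*, 𝔢(θ) = d·[[−1, e^{iθ}],[e^{−iθ}, −1]], X = [[1/2,−1/16],[−1/16,1/2]], and 𝔩(θ) = (27/70)·d·μ·c·(2 − 2cos θ)·(I_2 ⊗ X). Then for every θ ∈ [−π,π] with cos θ ≠ 1, the Schur-complement symbol satisfies 𝔰(θ) := (1/c)·𝔢(θ) − 𝔡(θ)·𝔩(θ)^{−1}·𝔤(θ) = (d/c)·[[−1 − 5a/μ, e^{iθ} − 3a/μ],[e^{−iθ} − 3a/μ, −1 − 5a/μ]]. -/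
open Matrix

/-- **The Schur complement symbol.** For `d, μ, c > 0` and `a = 105/2016`, with
`g₀ = [[3,1],[3,1],[1,3],[1,3]]`, `𝔤(θ) = (3/64)d·g₀·(1-e^{iθ})`, `𝔡(θ) = 𝔤(θ)^*`,
`𝔢(θ) = d[[-1,e^{iθ}],[e^{-iθ},-1]]` and
`𝔩(θ) = (27/70)dμc(2-2cosθ)(I₂ ⊗ [[1/2,-1/16],[-1/16,1/2]])` (written here as an explicit
`4×4` matrix): for every `θ ∈ [-π,π]` with `cos θ ≠ 1`,
`𝔰(θ) = (1/c)𝔢(θ) - 𝔡(θ)𝔩(θ)⁻¹𝔤(θ) = (d/c)[[-1-5a/μ, e^{iθ}-3a/μ],[e^{-iθ}-3a/μ, -1-5a/μ]]`. -/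
theorem schur_complement_symbol
    (d μ c : ℝ) (hd : 0 < d) (hμ : 0 < μ) (hc : 0 < c)
    (a : ℝ) (ha : a = 105 / 2016)
    (θ : ℝ) (hθ : θ ∈ Set.Icc (-Real.pi) Real.pi) (hcos : Real.cos θ ≠ 1)
    (g0 : Matrix (Fin 4) (Fin 2) ℂ) (hg0 : g0 = !![3, 1; 3, 1; 1, 3; 1, 3])
    (g : Matrix (Fin 4) (Fin 2) ℂ)
    (hg : g = ((3 / 64 : ℂ) * (d : ℂ) * (1 - Complex.exp (Complex.I * (θ : ℂ)))) • g0)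
    (e : Matrix (Fin 2) (Fin 2) ℂ)
    (he : e = (d : ℂ) •
        !![-1, Complex.exp (Complex.I * (θ : ℂ));
           Complex.exp (-(Complex.I * (θ : ℂ))), -1])
    (l : Matrix (Fin 4) (Fin 4) ℂ)
    (hl : l = (((27 / 70) * d * μ * c * (2 - 2 * Real.cos θ) : ℝ) : ℂ) •
        !![(1 : ℂ)/2, -1/16, 0, 0;
           -1/16, 1/2, 0, 0;
           0, 0, 1/2, -1/16;
           0, 0, -1/16, 1/2]) :
    (1 / (c : ℂ)) • e - gᴴ * l⁻¹ * g =
      (((d / c : ℝ)) : ℂ) •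
        !![((-1 - 5 * a / μ : ℝ) : ℂ),
             Complex.exp (Complex.I * (θ : ℂ)) - ((3 * a / μ : ℝ) : ℂ);
           Complex.exp (-(Complex.I * (θ : ℂ))) - ((3 * a / μ : ℝ) : ℂ),
             ((-1 - 5 * a / μ : ℝ) : ℂ)] := by
  have hzw : Complex.exp (Complex.I * (θ : ℂ)) * Complex.exp (-(Complex.I * (θ : ℂ))) = 1 := by
    rw [← Complex.exp_add]; simp
  have hsum : 2 * (Real.cos θ : ℂ) =
      Complex.exp (Complex.I * (θ : ℂ)) + Complex.exp (-(Complex.I * (θ : ℂ))) := by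
    rw [Complex.ofReal_cos, Complex.two_cos, neg_mul, mul_comm (θ : ℂ)]
  have hstar : star (Complex.exp (Complex.I * (θ : ℂ))) =
      Complex.exp (-(Complex.I * (θ : ℂ))) := by
    rw [Complex.star_def, ← Complex.exp_conj]; simp
  have hd0 : (d : ℂ) ≠ 0 := by exact_mod_cast hd.ne'
  have hm0 : (μ : ℂ) ≠ 0 := by exact_mod_cast hμ.ne'
  have hc0 : (c : ℂ) ≠ 0 := by exact_mod_cast hc.ne'
  have ht0 : (2 - 2 * (Real.cos θ : ℂ)) ≠ 0 := by
    intro h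
    apply hcos
    have h' : (2 - 2 * Real.cos θ : ℝ) = 0 := by exact_mod_cast h
    linarith
  have hgstar : gᴴ = ((3 / 64 : ℂ) * d * (1 - Complex.exp (-(Complex.I * (θ : ℂ))))) •
      !![3, 3, 1, 1; 1, 1, 3, 3] := by
    rw [hg, conjTranspose_smul, hg0]
    congr 1
    · simp only [star_mul', star_sub, star_one, hstar]
      simp
    · ext i j
      fin_cases i <;> fin_cases j <;> simp
  have hlinv : l⁻¹ = (((27 / 70) * d * μ * c * (2 - 2 * (Real.cos θ : ℂ)))⁻¹ : ℂ) •
      !![(128 : ℂ)/63, 16/63, 0, 0;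
         16/63, 128/63, 0, 0;
         0, 0, 128/63, 16/63;
         0, 0, 16/63, 128/63] := by
    apply inv_eq_right_inv
    rw [hl, smul_mul_smul_comm]
    push_cast
    rw [← Complex.ofReal_cos, mul_inv_cancel₀ (by
      simp only [ne_eq, mul_eq_zero, hd0, hm0, hc0, ht0]; norm_num), one_smul]
    ext i j
    fin_cases i <;> fin_cases j <;>
      simp [Matrix.mul_apply, Fin.sum_univ_four] <;> norm_num
  rw [hgstar, hlinv, hg, hg0, he, ha]
  simp only [Matrix.smul_mul, Matrix.mul_smul]
  rw [hsum] at ht0 ⊢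
  generalize Complex.exp (Complex.I * (θ : ℂ)) = z at *
  generalize Complex.exp (-(Complex.I * (θ : ℂ))) = w at *
  have ht : (1 - w) * (1 - z) = 2 - (z + w) := by linear_combination hzw
  have hk : (3 / 64 * (d : ℂ) * (1 - z)) * ((27 / 70 * d * μ * c * (2 - (z + w)))⁻¹ *
      (3 / 64 * d * (1 - w))) = 35 / 6144 * (d / (μ * c)) := by
    field_simp
    linear_combination 3870720 * ht
  have hprod : (!![3, 3, 1, 1; 1, 1, 3, 3] : Matrix (Fin 2) (Fin 4) ℂ) *
      !![(128 : ℂ)/63, 16/63, 0, 0;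
         16/63, 128/63, 0, 0;
         0, 0, 128/63, 16/63;
         0, 0, 16/63, 128/63] * (!![3, 1; 3, 1; 1, 3; 1, 3] : Matrix (Fin 4) (Fin 2) ℂ) =
      !![320 / 7, 192 / 7; 192 / 7, 320 / 7] := by
    ext i j
    fin_cases i <;> fin_cases j <;>
      simp [Matrix.mul_apply, Fin.sum_univ_four] <;> norm_num
  simp only [hprod, smul_smul, hk]
  ext i j
  fin_cases i <;> fin_cases j <;> simp <;> field_simp <;> ring
end
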